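/- arXiv:1007.3795 — 2 statements merged into one kernel-verified Lean document; each statement's English description precedes it below -/
import Mathlib

section
/- The Boltzmann and boundary Boltzmann weights satisfy the boundary Yang–Baxter (reflection) equation: for all a, b, c, d, e ∈ ℂ^N and all u, v ∈ ℂ such that every theta-function denominator and every h-factor occurring in the displayed weights is defined and nonzero, Σ_{f,g} W(c,f;b,a|u−v)·W(c,d;f,g|u+v)·K(g,f,a|u)·K(e,d,g|v) = Σ_{f,g} W(c,d;f,e|u−v)·W(c,f;b,g|u+v)·K(e,f,g|u)·K(g,b,a|v), where the sums run over f, g ∈ ℂ^N and have only finitely many nonzero terms (the weights vanish on non-admissible configurations). -/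
open scoped Classical

noncomputable section

/-- `x^w := exp(w · log x)` for a real base `x` and a complex exponent `w`. -/
def cxp (x : ℝ) (w : ℂ) : ℂ := Complex.exp (w * Real.log x)

/-- The infinite product `(z;p)_∞ = ∏_{n≥0} (1 - z pⁿ)`. -/
def qpoch (z p : ℂ) : ℂ := ∏' n : ℕ, (1 - z * p ^ n)

/-- The double infinite product `(z;p,q)_∞ = ∏_{n₁,n₂≥0} (1 - z p^{n₁} q^{n₂})`. -/
def qpoch2 (z p q : ℂ) : ℂ := ∏' n : ℕ × ℕ, (1 - z * p ^ n.1 * q ^ n.2)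

/-- The theta function `Θ_p(z) = (p;p)_∞ (z;p)_∞ (p/z;p)_∞`. -/
def jtheta (p z : ℂ) : ℂ := qpoch p p * qpoch z p * qpoch (p / z) p

/-- The elliptic theta function `[u] = x^{u²/r - u} Θ_{x^{2r}}(x^{2u})`. -/
def ebr (x : ℝ) (r : ℕ) (u : ℂ) : ℂ :=
  cxp x (u ^ 2 / (r : ℂ) - u) * jtheta (cxp x (2 * r)) (cxp x (2 * u))

/-- `φ(z) = (x²z;x^{2r},x^{2N})_∞ (x^{2r+2N-2}z;x^{2r},x^{2N})_∞ /
((x^{2r}z;x^{2r},x^{2N})_∞ (x^{2N}z;x^{2r},x^{2N})_∞)`. -/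
def phiW (x : ℝ) (N r : ℕ) (z : ℂ) : ℂ :=
  qpoch2 (cxp x 2 * z) (cxp x (2 * r)) (cxp x (2 * N)) *
    qpoch2 (cxp x (2 * r + 2 * N - 2) * z) (cxp x (2 * r)) (cxp x (2 * N)) /
  (qpoch2 (cxp x (2 * r) * z) (cxp x (2 * r)) (cxp x (2 * N)) *
    qpoch2 (cxp x (2 * N) * z) (cxp x (2 * r)) (cxp x (2 * N)))

/-- The normalization `R(u) = z^{((r-1)/r)((N-1)/N)} φ(1/z)/φ(z)`, `z = x^{2u}`,
with `z^s := exp(2us·log x)`. -/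
def RW (x : ℝ) (N r : ℕ) (u : ℂ) : ℂ :=
  Complex.exp (2 * u * ((((r : ℂ) - 1) / (r : ℂ)) * (((N : ℂ) - 1) / (N : ℂ))) * Real.log x) *
    phiW x N r (cxp x (-2 * u)) / phiW x N r (cxp x (2 * u))

/-- The `μ`-th standard basis vector of `ℂ^N`. -/
def stdv (N : ℕ) (μ : Fin N) : Fin N → ℂ := fun i => if i = μ then 1 else 0

/-- The Boltzmann weight `W(c,d;b,a|u)` of the `U_{q,p}(A_{N-1}^{(1)})` face model:
it vanishes unless the configuration `(a,b,c,d)` is admissible, and on admissible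
configurations it is given by the three elliptic expressions of the paper. -/
def W (x : ℝ) (N r : ℕ) (cc dd bb aa : Fin N → ℂ) (u : ℂ) : ℂ :=
  (∑ μ : Fin N,
    if bb = aa + stdv N μ ∧ dd = aa + stdv N μ ∧ cc = aa + stdv N μ + stdv N μ then
      RW x N r u
    else 0)
  + (∑ μ : Fin N, ∑ ν : Fin N,
      if μ ≠ ν ∧ bb = aa + stdv N ν ∧ dd = aa + stdv N μ ∧ cc = aa + stdv N μ + stdv N ν then
        RW x N r u * ebr x r u * ebr x r (aa μ - aa ν - 1) /
          (ebr x r (u - 1) * ebr x r (aa μ - aa ν))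
      else 0)
  + (∑ μ : Fin N, ∑ ν : Fin N,
      if μ ≠ ν ∧ bb = aa + stdv N ν ∧ dd = aa + stdv N ν ∧ cc = aa + stdv N μ + stdv N ν then
        RW x N r u * ebr x r (u - (aa μ - aa ν)) * ebr x r 1 /
          (ebr x r (u - 1) * ebr x r (aa μ - aa ν))
      else 0)

/-- The normalization `h_a(z)` of the boundary Boltzmann weights (`cb` is the
boundary parameter `c`; `hN : 0 < N` gives access to the first coordinate `a_1`). -/
def hK (x : ℝ) (N r : ℕ) (cb : ℝ) (hN : 0 < N) (aa : Fin N → ℂ) (z : ℂ) : ℂ :=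
  (qpoch2 (cxp x (2 * r + 2 * N - 2) / z ^ 2) (cxp x (2 * r)) (cxp x (4 * N)) *
      qpoch2 (cxp x (2 * N + 2) / z ^ 2) (cxp x (2 * r)) (cxp x (4 * N)) /
    (qpoch2 (cxp x (2 * r) / z ^ 2) (cxp x (2 * r)) (cxp x (4 * N)) *
      qpoch2 (cxp x (4 * N) / z ^ 2) (cxp x (2 * r)) (cxp x (4 * N)))) *
  (qpoch2 (cxp x (2 * N + 2 * cb) / z) (cxp x (2 * r)) (cxp x (2 * N)) *
      qpoch2 (cxp x (2 * r - 2 * cb) / z) (cxp x (2 * r)) (cxp x (2 * N)) /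
    (qpoch2 (cxp x (2 * N + 2 * r - 2 * cb - 2) / z) (cxp x (2 * r)) (cxp x (2 * N)) *
      qpoch2 (cxp x (2 * cb + 2) / z) (cxp x (2 * r)) (cxp x (2 * N)))) *
  ∏ j : Fin N,
    if j ≠ ⟨0, hN⟩ then
      qpoch2 (cxp x ((2 * r + 2 * N - 2 * cb : ℂ) - 2 * (aa ⟨0, hN⟩ - aa j)) / z)
          (cxp x (2 * r)) (cxp x (2 * N)) *
        qpoch2 (cxp x ((2 * cb : ℂ) + 2 * (aa ⟨0, hN⟩ - aa j)) / z)
          (cxp x (2 * r)) (cxp x (2 * N)) /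
      (qpoch2 (cxp x ((2 * r + 2 * N - 2 * cb : ℂ) - 2 * (aa ⟨0, hN⟩ - aa j) - 2) / z)
          (cxp x (2 * r)) (cxp x (2 * N)) *
        qpoch2 (cxp x ((2 * cb + 2 : ℂ) + 2 * (aa ⟨0, hN⟩ - aa j)) / z)
          (cxp x (2 * r)) (cxp x (2 * N)))
    else 1

/-- The boundary Boltzmann weight `K(top, side, bot | u)`: it vanishes unless
`top = bot` and `side = top + e_μ`, in which case it equals
`z^{((r-1)/r)((N-1)/N) - (2/r)a_1} (h_a(z)/h_a(1/z)) [c-u][a_{1,μ}+c+u]/([c+u][a_{1,μ}+c-u])`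
with `z = x^{2u}` and `a = top`. -/
def KB (x : ℝ) (N r : ℕ) (cb : ℝ) (hN : 0 < N)
    (top side bot : Fin N → ℂ) (u : ℂ) : ℂ :=
  ∑ μ : Fin N,
    if top = bot ∧ side = top + stdv N μ then
      Complex.exp (2 * u *
          ((((r : ℂ) - 1) / (r : ℂ)) * (((N : ℂ) - 1) / (N : ℂ)) -
            (2 / (r : ℂ)) * top ⟨0, hN⟩) * Real.log x) *
        (hK x N r cb hN top (cxp x (2 * u)) / hK x N r cb hN top (cxp x (-2 * u))) *
        ebr x r ((cb : ℂ) - u) * ebr x r (top ⟨0, hN⟩ - top μ + cb + u) /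
        (ebr x r ((cb : ℂ) + u) * ebr x r (top ⟨0, hN⟩ - top μ + cb - u))
    else 0

lemma aux_summable_quad (A B : ℂ) (t : ℝ) (ht : t < 0) :
    Summable fun k : ℤ => Complex.exp (A + B * k + t * (k : ℂ) ^ 2) := by
  have hpi : (Real.pi : ℂ) ≠ 0 := by exact_mod_cast Real.pi_ne_zero
  have h := (summable_jacobiTheta₂_term_iff (B / (2 * Real.pi * Complex.I))
    (((-t / Real.pi : ℝ) : ℂ) * Complex.I)).2 (by
      simp only [Complex.mul_im, Complex.ofReal_re, Complex.I_im, Complex.ofReal_im, Complex.I_re]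
      have : 0 < -t / Real.pi := div_pos (by linarith) Real.pi_pos
      linarith)
  refine (h.mul_left (Complex.exp A)).congr fun k => ?_
  rw [jacobiTheta₂_term, ← Complex.exp_add]
  congr 1
  push_cast
  field_simp
  linear_combination -(k:ℂ)^2 * t * Complex.I_sq

/-- q-factorials -/
def qfac (q : ℝ) (n : ℕ) : ℝ := ∏ i ∈ Finset.range n, (1 - q ^ (i + 1))

/-- q-binomials -/
def qbn (q : ℝ) : ℕ → ℕ → ℝ
  | 0, 0 => 1
  | 0, _ + 1 => 0
  | _ + 1, 0 => 1
  | M + 1, k + 1 => q ^ (k + 1) * qbn q M (k + 1) + qbn q M k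

lemma qbn_zero_right (q : ℝ) (M : ℕ) : qbn q M 0 = 1 := by
  cases M <;> simp [qbn]

lemma qbn_lt (q : ℝ) (M k : ℕ) (h : M < k) : qbn q M k = 0 := by
  induction M generalizing k with
  | zero => cases k with
    | zero => omega
    | succ k => simp [qbn]
  | succ M ih => cases k with
    | zero => omega
    | succ k => simp [qbn, ih (k+1) (by omega), ih k (by omega)]

lemma qfac_succ (q : ℝ) (n : ℕ) : qfac q (n + 1) = qfac q n * (1 - q ^ (n + 1)) := by
  simp [qfac, Finset.prod_range_succ]

lemma qbn_self (q : ℝ) (k : ℕ) : qbn q k k = 1 := by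
  induction k with
  | zero => simp [qbn]
  | succ k ih => simp [qbn, ih, qbn_lt]

lemma qbn_fac (q : ℝ) (M : ℕ) : ∀ n k : ℕ, n + k = M →
    qbn q M k * qfac q k * qfac q n = qfac q M := by
  induction M with
  | zero => intro n k h; obtain ⟨rfl, rfl⟩ : n = 0 ∧ k = 0 := by omega
            simp [qbn, qfac]
  | succ M ih =>
    intro n k h
    cases k with
    | zero => obtain rfl : n = M + 1 := by omega
              simp [qbn, qfac]
    | succ k =>
      cases n with
      | zero => obtain rfl : k = M := by omega
                rw [qbn_self]; simp [qfac]
      | succ n =>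
        have h1 := ih n (k + 1) (by omega)
        have h2 := ih (n + 1) k (by omega)
        rw [qbn, qfac_succ q M, ← show n + 1 + k = M by omega]
        rw [show M = n + 1 + k by omega] at h1 h2
        rw [qfac_succ] at *
        rw [qfac_succ] at *
        have : q ^ (n + 1 + k + 1) = q ^ (n + 1) * q ^ (k + 1) := by ring
        rw [this]
        linear_combination q ^ (k+1) * (1 - q ^ (n + 1)) * h1 + (1 - q ^ (k + 1)) * h2

lemma qbinomial (q : ℝ) (M : ℕ) : ∀ y : ℂ, ∏ n ∈ Finset.range M, (1 - y * (q : ℂ) ^ n) =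
    ∑ k ∈ Finset.range (M + 1), (-1) ^ k * (q : ℂ) ^ (k.choose 2) * (qbn q M k : ℂ) * y ^ k := by
  induction M with
  | zero => intro y; simp [qbn]
  | succ M ih =>
    intro y
    rw [Finset.prod_range_succ', Finset.sum_range_succ']
    have := ih (y * q)
    rw [Finset.prod_congr rfl (g := fun n => (1 - y * q * (q : ℂ) ^ n)) (fun n _ => by ring), this]
    have e1 : ∑ k ∈ Finset.range (M + 1), (-1) ^ k * (q : ℂ) ^ (k.choose 2) * (qbn q M k : ℂ) * (y*q) ^ k
      = ∑ k ∈ Finset.range (M + 1), (-1) ^ (k+1) * (q : ℂ) ^ ((k+1).choose 2) * (qbn q M (k+1) : ℂ) * (y*q) ^ (k+1) + 1 := by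
      have := Finset.sum_range_succ (fun k => (-1) ^ k * (q : ℂ) ^ (k.choose 2) * (qbn q M k : ℂ) * (y*q) ^ k) (M+1)
      rw [Finset.sum_range_succ'] at this
      rw [qbn_lt q M (M+1) (by omega), qbn_zero_right] at this
      simp at this
      exact this.symm
    rw [pow_zero, mul_one, mul_sub, mul_one]
    nth_rewrite 1 [e1]
    rw [Finset.sum_mul, add_sub_right_comm, ← Finset.sum_sub_distrib]
    congr 1
    · refine Finset.sum_congr rfl fun k _ => ?_
      rw [qbn]
      have : (k+1).choose 2 = k.choose 2 + k := by
        rw [Nat.choose_succ_succ]; simp [add_comm]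
      rw [this]
      push_cast
      ring
    · simp [qbn]

lemma qfac_lim (q : ℝ) (h0 : 0 < q) (h1 : q < 1) : ∃ L : ℝ, 0 < L ∧
    Filter.Tendsto (qfac q) Filter.atTop (nhds L) ∧ (∀ n, L ≤ qfac q n) ∧ ∀ n, qfac q n ≤ 1 := by
  have hs : Summable fun n : ℕ => ‖-(q ^ (n + 1))‖ := by
    have := (summable_nat_add_iff 1).2 (summable_geometric_of_lt_one h0.le h1)
    refine this.congr fun n => ?_
    rw [norm_neg, Real.norm_of_nonneg (by positivity)]
  have hlt : ∀ n : ℕ, q ^ (n + 1) < 1 := fun n => pow_lt_one₀ h0.le h1 (by omega)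
  have hpos : ∀ n, 0 < qfac q n := fun n => Finset.prod_pos fun i _ => by
    have := hlt i; linarith
  have hm : Multipliable fun n : ℕ => (1 + -(q ^ (n + 1))) :=
    multipliable_one_add_of_summable hs
  have hne : ∏' n : ℕ, (1 + -(q ^ (n + 1))) ≠ 0 :=
    tprod_one_add_ne_zero_of_summable (fun n => by have := hlt n; linarith) hs
  have ht : Filter.Tendsto (qfac q) Filter.atTop (nhds (∏' n : ℕ, (1 + -(q ^ (n + 1))))) := by
    have := hm.hasProd.tendsto_prod_nat
    exact this
  have hanti : Antitone (qfac q) := antitone_nat_of_succ_le fun n => by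
    rw [qfac_succ]
    have := hpos n
    have h3 : 0 < q ^ (n+1) := by positivity
    nlinarith
  refine ⟨_, lt_of_le_of_ne (ge_of_tendsto' ht fun n => (hpos n).le) hne.symm, ht,
    fun n => hanti.le_of_tendsto ht n, fun n => ?_⟩
  have := hanti (Nat.zero_le n)
  simpa [qfac] using this

/-- symmetric q-binomial coefficient -/
def qB (q : ℝ) (m : ℕ) (j : ℤ) : ℝ :=
  if j ∈ Finset.Icc (-(m : ℤ)) m then qbn q (2 * m) (m + j).toNat else 0

lemma qB_eq (q : ℝ) (h0 : 0 < q) (h1 : q < 1) (m : ℕ) (j : ℤ)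
    (h : j ∈ Finset.Icc (-(m : ℤ)) m) :
    qB q m j = qfac q (2 * m) / (qfac q (m + j).toNat * qfac q (m - j).toNat) := by
  obtain ⟨L, hL, -, hle, -⟩ := qfac_lim q h0 h1
  rw [Finset.mem_Icc] at h
  have := qbn_fac q (2 * m) (m - j).toNat (m + j).toNat (by omega)
  rw [qB, if_pos (by rw [Finset.mem_Icc]; exact h), eq_div_iff, ← this, mul_assoc]
  exact mul_ne_zero (by linarith [hle (m + j).toNat]) (by linarith [hle (m - j).toNat])

lemma qB_lim (q : ℝ) (h0 : 0 < q) (h1 : q < 1) : ∃ C D : ℝ,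
    (∀ m j, |qB q m j| ≤ D) ∧ ∀ j, Filter.Tendsto (fun m => qB q m j) Filter.atTop (nhds C) := by
  obtain ⟨L, hL, ht, hle, hle1⟩ := qfac_lim q h0 h1
  refine ⟨L / (L * L), 1 / (L * L), fun m j => ?_, fun j => ?_⟩
  · by_cases h : j ∈ Finset.Icc (-(m : ℤ)) m
    · rw [qB_eq q h0 h1 m j h, abs_of_nonneg]
      · have a1 := hle (m + j).toNat
        have a2 := hle (m - j).toNat
        have a3 := hle1 (2 * m)
        have a4 : 0 ≤ qfac q (m + j).toNat := by linarith
        gcongr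
      · have a1 := hle (m + j).toNat
        have a2 := hle (m - j).toNat
        have a3 := hle (2 * m)
        exact div_nonneg (by linarith) (mul_nonneg (by linarith) (by linarith))
    · rw [qB, if_neg h, abs_zero]; positivity
  · have t1 : Filter.Tendsto (fun m : ℕ => 2 * m) Filter.atTop Filter.atTop :=
      Filter.tendsto_atTop_mono (fun m => by simp only [id]; omega) Filter.tendsto_id
    have t2 : Filter.Tendsto (fun m : ℕ => ((m : ℤ) + j).toNat) Filter.atTop Filter.atTop := by
      refine Filter.tendsto_atTop_mono (f := fun m : ℕ => m - j.natAbs) (fun m => ?_) (Filter.tendsto_sub_atTop_nat _)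
      omega
    have t3 : Filter.Tendsto (fun m : ℕ => ((m : ℤ) - j).toNat) Filter.atTop Filter.atTop := by
      refine Filter.tendsto_atTop_mono (f := fun m : ℕ => m - j.natAbs) (fun m => ?_) (Filter.tendsto_sub_atTop_nat _)
      omega
    have := (ht.comp t1).div ((ht.comp t2).mul (ht.comp t3)) (by positivity)
    refine this.congr' ?_
    filter_upwards [Filter.eventually_ge_atTop j.natAbs] with m hm
    rw [qB_eq q h0 h1 m j (by rw [Finset.mem_Icc]; omega)]
    rfl

lemma finite_triple (T : ℝ) (ζ : ℂ) (m : ℕ) :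
    (∏ n ∈ Finset.range m, (1 - Complex.exp ζ * ((Real.exp (2 * T) : ℝ) : ℂ) ^ n)) *
    (∏ n ∈ Finset.range m, (1 - ((Real.exp (2 * T) : ℝ) : ℂ) / Complex.exp ζ *
      ((Real.exp (2 * T) : ℝ) : ℂ) ^ n)) =
    ∑' j : ℤ, ((qB (Real.exp (2 * T)) m j : ℝ) : ℂ) *
      ((-1) ^ j * Complex.exp (T * ((j : ℂ) ^ 2 - j) + ζ * j)) := by
  have hq : ((Real.exp (2 * T) : ℝ) : ℂ) = Complex.exp (2 * T) := by push_cast; rfl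
  have hb := qbinomial (Real.exp (2 * T)) (2 * m) (Complex.exp (ζ - 2 * T * m))
  rw [two_mul, Finset.prod_range_add] at hb
  have p1 : ∏ n ∈ Finset.range m, (1 - Complex.exp (ζ - 2 * T * m) * ((Real.exp (2 * T) : ℝ) : ℂ) ^ (m + n))
    = ∏ n ∈ Finset.range m, (1 - Complex.exp ζ * ((Real.exp (2 * T) : ℝ) : ℂ) ^ n) := by
    refine Finset.prod_congr rfl fun n _ => ?_
    rw [hq, ← Complex.exp_nat_mul, ← Complex.exp_nat_mul, ← Complex.exp_add, ← Complex.exp_add]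
    congr 2
    push_cast; ring
  have p2 : ∀ m : ℕ, ∏ n ∈ Finset.range m, (1 - ((Real.exp (2 * T) : ℝ) : ℂ) / Complex.exp ζ *
      ((Real.exp (2 * T) : ℝ) : ℂ) ^ n) = (-1) ^ m * Complex.exp (T * (m ^ 2 + m) - ζ * m) *
       ∏ n ∈ Finset.range m, (1 - Complex.exp (ζ - 2 * T * m) * ((Real.exp (2 * T) : ℝ) : ℂ) ^ n) := by
    intro m
    rw [← Finset.prod_range_reflect (fun n => (1 - Complex.exp (ζ - 2 * T * m) * ((Real.exp (2 * T) : ℝ) : ℂ) ^ n))]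
    have : (-1) ^ m * Complex.exp (T * (m ^ 2 + m) - ζ * m) =
        ∏ n ∈ Finset.range m, (-Complex.exp (2 * T * (n + 1) - ζ)) := by
      induction m with
      | zero => simp
      | succ m ih =>
        rw [Finset.prod_range_succ, ← ih, pow_succ]
        have : Complex.exp (T * (((m + 1 : ℕ) : ℂ) ^ 2 + (m + 1 : ℕ)) - ζ * (m + 1 : ℕ)) =
          Complex.exp (T * (m ^ 2 + m) - ζ * m) * Complex.exp (2 * T * (m + 1) - ζ) := by
          rw [← Complex.exp_add]; congr 1; push_cast; ring
        rw [this]; ring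
    rw [this, ← Finset.prod_mul_distrib]
    refine Finset.prod_congr rfl fun n hn => ?_
    rw [Finset.mem_range] at hn
    rw [hq, ← Complex.exp_nat_mul, ← Complex.exp_nat_mul, ← Complex.exp_sub, ← Complex.exp_add, ← Complex.exp_add]
    have e1 : Complex.exp (2 * T - ζ + n * (2 * T)) = Complex.exp (2 * T * (n + 1) - ζ) := by
      congr 1; ring
    have e2 : Complex.exp (ζ - 2 * T * m + (m - 1 - n : ℕ) * (2 * T)) = Complex.exp (-(2 * T * (n + 1) - ζ)) := by
      congr 1
      rw [show ((m - 1 - n : ℕ) : ℂ) = m - 1 - n by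
        rw [Nat.sub_sub, Nat.cast_sub (by omega)]; push_cast; ring]
      ring
    rw [e1, e2, Complex.exp_neg]
    field_simp [Complex.exp_ne_zero]
    ring
  rw [p1] at hb
  rw [p2 m, mul_left_comm, mul_comm (∏ n ∈ Finset.range m, (1 - Complex.exp ζ * _)), hb, ← two_mul]
  rw [tsum_eq_sum (s := Finset.Icc (-(m : ℤ)) m) (fun j hj => by simp [qB, hj]), Finset.mul_sum]
  refine Finset.sum_nbij' (fun k => (k : ℤ) - m) (fun j => (m + j).toNat) ?_ ?_ ?_ ?_ ?_
  · intro k hk; simp at hk ⊢; omega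
  · intro k hk; simp at hk ⊢; omega
  · intro k hk; simp at hk ⊢
  · intro k hk; simp at hk ⊢; omega
  · intro k hk
    rw [Finset.mem_range] at hk
    rw [qB, if_pos (by rw [Finset.mem_Icc]; omega), show ((m : ℤ) + (k - m)).toNat = k by omega]
    have hsgn : ((-1 : ℂ)) ^ ((k : ℤ) - m) = (-1) ^ m * (-1) ^ k := by
      rw [zpow_sub₀ (by norm_num), zpow_natCast, zpow_natCast, div_eq_iff (by simp)]
      have : ((-1 : ℂ)) ^ m * (-1) ^ m = 1 := by rw [← mul_pow]; simp
      linear_combination -(-1 : ℂ) ^ k * this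
    have hc : ((Real.exp (2 * T) : ℝ) : ℂ) ^ (k.choose 2) = Complex.exp (T * ((k : ℂ) ^ 2 - k)) := by
      rw [hq, ← Complex.exp_nat_mul]
      congr 1
      rw [Nat.cast_choose_two]; ring
    have he : Complex.exp (T * ((((k : ℤ) - m : ℤ) : ℂ) ^ 2 - (((k : ℤ) - m : ℤ) : ℂ)) + ζ * (((k : ℤ) - m : ℤ) : ℂ)) =
       Complex.exp (T * (m ^ 2 + m) - ζ * m) * Complex.exp (T * ((k : ℂ) ^ 2 - k)) * Complex.exp (ζ - 2 * T * m) ^ k := by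
      rw [← Complex.exp_nat_mul, ← Complex.exp_add, ← Complex.exp_add]
      congr 1; push_cast; ring
    rw [hsgn, hc, he]
    ring


lemma qpoch_tendsto (z : ℂ) (q : ℝ) (h0 : 0 < q) (h1 : q < 1) :
    Filter.Tendsto (fun m => ∏ n ∈ Finset.range m, (1 - z * (q : ℂ) ^ n)) Filter.atTop
      (nhds (qpoch z q)) := by
  have hs : Summable fun n : ℕ => ‖-(z * (q : ℂ) ^ n)‖ := by
    refine ((summable_geometric_of_lt_one h0.le h1).mul_left ‖z‖).congr fun n => ?_
    rw [norm_neg, norm_mul, norm_pow, Complex.norm_real, Real.norm_of_nonneg h0.le]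
  have hm := multipliable_one_add_of_summable hs
  have := hm.hasProd.tendsto_prod_nat
  simp only [← sub_eq_add_neg] at this
  exact this

lemma neg_one_zpow_norm (k : ℤ) : ‖((-1 : ℂ)) ^ k‖ = 1 := by simp

lemma triple_product (T : ℝ) (hT : T < 0) : ∃ C : ℂ, ∀ ζ : ℂ,
    qpoch (Complex.exp ζ) ((Real.exp (2 * T) : ℝ) : ℂ) *
      qpoch (((Real.exp (2 * T) : ℝ) : ℂ) / Complex.exp ζ) ((Real.exp (2 * T) : ℝ) : ℂ) =
    C * ∑' j : ℤ, ((-1) ^ j * Complex.exp (T * ((j : ℂ) ^ 2 - j) + ζ * j)) := by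
  have h0 : 0 < Real.exp (2 * T) := Real.exp_pos _
  have h1 : Real.exp (2 * T) < 1 := by rw [Real.exp_lt_one_iff]; linarith
  obtain ⟨C, D, hD, hC⟩ := qB_lim _ h0 h1
  refine ⟨C, fun ζ => ?_⟩
  have hl := (qpoch_tendsto (Complex.exp ζ) _ h0 h1).mul
    (qpoch_tendsto (((Real.exp (2 * T) : ℝ) : ℂ) / Complex.exp ζ) _ h0 h1)
  refine tendsto_nhds_unique hl ?_
  simp_rw [finite_triple T ζ]
  rw [← tsum_mul_left]
  have hs := (aux_summable_quad 0 (ζ - T) T hT).norm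
  refine tendsto_tsum_of_dominated_convergence (hs.mul_left D) (fun j => ?_)
    (Filter.Eventually.of_forall fun m j => ?_)
  · refine Filter.Tendsto.mul_const _ ?_
    exact (Complex.continuous_ofReal.tendsto C).comp (hC j)
  · rw [norm_mul, norm_mul, neg_one_zpow_norm, one_mul, Complex.norm_real]
    have : (T * ((j : ℂ) ^ 2 - j) + ζ * j) = 0 + (ζ - T) * j + T * (j : ℂ) ^ 2 := by ring
    rw [this]
    gcongr
    exact hD m j

lemma ebr_series (x : ℝ) (hx0 : 0 < x) (hx1 : x < 1) (r : ℕ) (hr : 0 < r) : ∃ C : ℂ, ∀ u : ℂ,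
    ebr x r u = C * ∑' k : ℤ, (-1) ^ k *
      Complex.exp ((Real.log x : ℂ) / r * (u + r * (k - 1 / 2)) ^ 2) := by
  have hl : Real.log x < 0 := Real.log_neg hx0 hx1
  have hrR : (0 : ℝ) < r := by exact_mod_cast hr
  have hrC : (r : ℂ) ≠ 0 := by exact_mod_cast hr.ne'
  obtain ⟨C, hC⟩ := triple_product (r * Real.log x) (by nlinarith)
  have hp : cxp x (2 * r) = ((Real.exp (2 * (r * Real.log x)) : ℝ) : ℂ) := by
    rw [cxp]; push_cast; congr 1; ring
  refine ⟨qpoch (cxp x (2 * r)) (cxp x (2 * r)) * C *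
    Complex.exp (-(Real.log x : ℂ) * r / 4), fun u => ?_⟩
  have := hC (2 * u * Real.log x)
  rw [← hp] at this
  rw [ebr, jtheta, mul_assoc (qpoch _ _), show cxp x (2 * u) = Complex.exp (2 * u * Real.log x) from rfl, this]
  rw [mul_assoc _ (Complex.exp _), ← tsum_mul_left (a := Complex.exp _)]
  rw [show ∀ a b c d : ℂ, a * (b * (c * d)) = b * c * (a * d) by intros; ring, ← tsum_mul_left (a := cxp _ _)]
  congr 1
  refine tsum_congr fun k => ?_
  rw [cxp, mul_left_comm, mul_left_comm (Complex.exp (-(Real.log x : ℂ) * r / 4)), ← Complex.exp_add, ← Complex.exp_add]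
  congr 2
  push_cast
  field_simp
  ring

/-- parity split of the lattice -/
def latEquiv : (ℤ × ℤ) ⊕ (ℤ × ℤ) ≃ ℤ × ℤ where
  toFun s := match s with
    | Sum.inl p => (p.1 + p.2, p.1 - p.2)
    | Sum.inr p => (p.1 + p.2, p.1 + 1 - p.2)
  invFun p := if (p.1 + p.2) % 2 = 0 then Sum.inl ((p.1 + p.2) / 2, (p.1 - p.2) / 2)
    else Sum.inr ((p.1 + p.2 - 1) / 2, (p.1 - p.2 + 1) / 2)
  left_inv s := by
    rcases s with ⟨i, j⟩ | ⟨i, j⟩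
    · simp only []
      rw [if_pos (by omega)]
      congr 2 <;> omega
    · simp only []
      rw [if_neg (by omega)]
      congr 2 <;> omega
  right_inv p := by
    rcases p with ⟨k, l⟩
    by_cases h : (k + l) % 2 = 0
    · simp only [h, if_true]
      ext <;> simp only [] <;> omega
    · simp only [h, if_false]
      ext <;> simp only [] <;> omega

lemma theta_dec (x : ℝ) (hx0 : 0 < x) (hx1 : x < 1) (r : ℕ) (hr : 0 < r) : ∃ O V : ℂ → ℂ,
    ∀ p q : ℂ, ebr x r (p + q) * ebr x r (p - q) = O p * V q - V p * O q := by
  have hl : Real.log x < 0 := Real.log_neg hx0 hx1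
  have hrR : (0 : ℝ) < r := by exact_mod_cast hr
  have hrC : (r : ℂ) ≠ 0 := by exact_mod_cast hr.ne'
  obtain ⟨C, hC⟩ := ebr_series x hx0 hx1 r hr
  set l : ℂ := (Real.log x : ℂ) with hldef
  let H : ℂ → ℤ → ℂ := fun w j => Complex.exp (2 * l / r * (w + r * j) ^ 2)
  let t : ℂ → ℤ → ℂ := fun u k => (-1) ^ k * Complex.exp (l / r * (u + r * (k - 1 / 2)) ^ 2)
  have hH : ∀ w, Summable fun j => ‖H w j‖ := fun w => by
    refine ((aux_summable_quad (2 * l / r * w ^ 2) (4 * l * w) (2 * Real.log x * r)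
      (by nlinarith)).congr fun k => ?_).norm
    congr 1
    push_cast
    field_simp
    ring
  have ht : ∀ w, Summable fun j => ‖t w j‖ := fun w => by
    have h := ((aux_summable_quad (l / r * (w - r / 2) ^ 2) (2 * l * (w - r / 2)) (Real.log x * r)
      (by nlinarith))).norm
    refine h.congr fun k => ?_
    simp only [t]
    rw [norm_mul, neg_one_zpow_norm, one_mul]
    congr 2
    push_cast
    field_simp
    ring
  refine ⟨fun p => C ^ 2 * ∑' j, H (p - r / 2) j, fun p => ∑' j, H p j, fun p q => ?_⟩
  rw [hC, hC]
  have e1 : (∑' k, t (p + q) k) * (∑' k, t (p - q) k) =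
      ∑' z : ℤ × ℤ, t (p + q) z.1 * t (p - q) z.2 :=
    tsum_mul_tsum_of_summable_norm (ht _) (ht _)
  have hsum : Summable fun z : ℤ × ℤ => t (p + q) z.1 * t (p - q) z.2 :=
    summable_mul_of_summable_norm (ht _) (ht _)
  have hsum' := (latEquiv.summable_iff).2 hsum
  rw [← latEquiv.tsum_eq, Summable.tsum_sum] at e1
  rotate_left
  · exact hsum'.comp_injective Sum.inl_injective
  · exact hsum'.comp_injective Sum.inr_injective
  have s1 : ∀ i j : ℤ, ((-1 : ℂ)) ^ (i + j) * (-1) ^ (i - j) = 1 := fun i j => by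
    rw [← zpow_add₀ (by norm_num), show i + j + (i - j) = 2 * i by ring, zpow_mul]
    norm_num
  have s2 : ∀ i j : ℤ, ((-1 : ℂ)) ^ (i + j) * (-1) ^ (i + 1 - j) = -1 := fun i j => by
    rw [← zpow_add₀ (by norm_num), show i + j + (i + 1 - j) = 2 * i + 1 by ring,
      zpow_add₀ (by norm_num), zpow_mul]
    norm_num
  have f1 : ∀ z : ℤ × ℤ, t (p + q) (latEquiv (Sum.inl z)).1 * t (p - q) (latEquiv (Sum.inl z)).2
      = H (p - r / 2) z.1 * H q z.2 := fun z => by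
    rcases z with ⟨i, j⟩
    simp only [t, H, latEquiv, Equiv.coe_fn_mk]
    rw [mul_mul_mul_comm, s1, one_mul, ← Complex.exp_add, ← Complex.exp_add]
    congr 1
    push_cast
    ring
  have f2 : ∀ z : ℤ × ℤ, t (p + q) (latEquiv (Sum.inr z)).1 * t (p - q) (latEquiv (Sum.inr z)).2
      = -(H p z.1 * H (q - r / 2) z.2) := fun z => by
    rcases z with ⟨i, j⟩
    simp only [t, H, latEquiv, Equiv.coe_fn_mk]
    rw [mul_mul_mul_comm, s2, neg_one_mul, ← Complex.exp_add, ← Complex.exp_add]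
    congr 2
    push_cast
    ring
  rw [tsum_congr f1, tsum_congr f2, tsum_neg, ← tsum_mul_tsum_of_summable_norm (hH _) (hH _),
    ← tsum_mul_tsum_of_summable_norm (hH _) (hH _)] at e1
  linear_combination C ^ 2 * e1

lemma ebr_neg (x : ℝ) (hx0 : 0 < x) (hx1 : x < 1) (r : ℕ) (hr : 0 < r) (u : ℂ) :
    ebr x r (-u) = -ebr x r u := by
  obtain ⟨C, hC⟩ := ebr_series x hx0 hx1 r hr
  rw [hC, hC, ← mul_neg, ← tsum_neg, ← (Equiv.subLeft (1 : ℤ)).tsum_eq]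
  congr 1
  refine tsum_congr fun k => ?_
  rw [Equiv.subLeft_apply, zpow_sub₀ (by norm_num), zpow_one, ← neg_mul]
  congr 1
  · rcases Int.even_or_odd k with h | h
    · simp [h.neg_one_zpow]
    · simp [h.neg_one_zpow]
  · congr 2
    push_cast
    ring

/-- the six-bracket identity behind the reflection equation -/
lemma six_term (x : ℝ) (hx0 : 0 < x) (hx1 : x < 1) (r : ℕ) (hr : 0 < r) (u v X Y : ℂ) :
    ebr x r (u + v) * (ebr x r (u - v - (Y - X)) * ebr x r (X + v) * ebr x r (Y - v) *
        ebr x r (X - u) * ebr x r (Y + u) +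
      ebr x r (u - v + (Y - X)) * ebr x r (X + u) * ebr x r (Y - u) *
        ebr x r (X - v) * ebr x r (Y + v)) =
    ebr x r (u - v) * (ebr x r (u + v + (Y - X)) * ebr x r (X + v) * ebr x r (X + u) *
        ebr x r (Y - u) * ebr x r (Y - v) +
      ebr x r (u + v - (Y - X)) * ebr x r (X - u) * ebr x r (X - v) *
        ebr x r (Y + u) * ebr x r (Y + v)) := by
  obtain ⟨O, V, h⟩ := theta_dec x hx0 hx1 r hr
  have g : ∀ s t p q : ℂ, p + q = s → p - q = t →
      ebr x r s * ebr x r t = O p * V q - V p * O q := by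
    rintro _ _ p q rfl rfl; exact h p q
  have g1 := g (u + v) (u - v - (Y - X)) (u - (Y - X) / 2) (v + (Y - X) / 2) (by ring) (by ring)
  have g2 := g (u + v) (u - v + (Y - X)) (u + (Y - X) / 2) (v - (Y - X) / 2) (by ring) (by ring)
  have g3 := g (u + v + (Y - X)) (u - v) (u + (Y - X) / 2) (v + (Y - X) / 2) (by ring) (by ring)
  have g4 := g (u + v - (Y - X)) (u - v) (u - (Y - X) / 2) (v - (Y - X) / 2) (by ring) (by ring)
  have F1 := g (X + v) (Y - v) ((X + Y) / 2) (v - (Y - X) / 2) (by ring) (by ring)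
  have F2 := g (Y + v) (X - v) ((X + Y) / 2) (v + (Y - X) / 2) (by ring) (by ring)
  have F3 := g (X + u) (Y - u) ((X + Y) / 2) (u - (Y - X) / 2) (by ring) (by ring)
  have F4 := g (Y + u) (X - u) ((X + Y) / 2) (u + (Y - X) / 2) (by ring) (by ring)
  calc _ = (ebr x r (u + v) * ebr x r (u - v - (Y - X))) * (ebr x r (X + v) * ebr x r (Y - v)) *
        (ebr x r (Y + u) * ebr x r (X - u)) +
        (ebr x r (u + v) * ebr x r (u - v + (Y - X))) * (ebr x r (X + u) * ebr x r (Y - u)) *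
        (ebr x r (Y + v) * ebr x r (X - v)) := by ring
    _ = (ebr x r (u + v + (Y - X)) * ebr x r (u - v)) * (ebr x r (X + v) * ebr x r (Y - v)) *
        (ebr x r (X + u) * ebr x r (Y - u)) +
        (ebr x r (u + v - (Y - X)) * ebr x r (u - v)) * (ebr x r (Y + u) * ebr x r (X - u)) *
        (ebr x r (Y + v) * ebr x r (X - v)) := by
      rw [g1, g2, g3, g4, F1, F2, F3, F4]; ring
    _ = _ := by ring


lemma stdv_inj (N : ℕ) (μ ν : Fin N) : stdv N μ = stdv N ν ↔ μ = ν := by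
  refine ⟨fun h => ?_, fun h => by rw [h]⟩
  have := congrFun h μ
  by_contra hne
  simp [stdv, hne] at this

lemma stdv_add_inj (N : ℕ) (a : Fin N → ℂ) (μ ν α β : Fin N)
    (h : a + stdv N μ + stdv N ν = a + stdv N α + stdv N β) :
    (α = μ ∧ β = ν) ∨ (α = ν ∧ β = μ) := by
  have hi : ∀ i, stdv N μ i + stdv N ν i = stdv N α i + stdv N β i := fun i => by
    have := congrFun h i
    simp only [Pi.add_apply, add_assoc] at this
    exact add_left_cancel this
  have h1 := hi α
  have h2 := hi β
  simp only [stdv] at h1 h2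
  have h3 := hi μ
  simp only [stdv] at h3
  by_cases e1 : α = μ
  · subst e1
    left
    refine ⟨rfl, ?_⟩
    have : stdv N ν = stdv N β := by
      funext i; exact add_left_cancel (hi i)
    exact ((stdv_inj N ν β).1 this).symm
  · by_cases e2 : α = ν
    · subst e2
      right
      refine ⟨rfl, ?_⟩
      have : stdv N μ = stdv N β := by
        funext i; have := hi i; rw [add_comm] at this; exact add_left_cancel this
      exact ((stdv_inj N μ β).1 this).symm
    · exfalso
      rw [if_neg e1, if_neg e2, if_pos trivial] at h1
      by_cases e3 : α = β
      · rw [if_pos e3] at h1; norm_num at h1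
      · simp [e3] at h1

lemma W_supp0 (x : ℝ) (N r : ℕ) (cc dd bb aa : Fin N → ℂ) (u : ℂ)
    (h : W x N r cc dd bb aa u ≠ 0) : ∃ μ ν : Fin N, cc = aa + stdv N μ + stdv N ν ∧
      (bb = aa + stdv N μ ∨ bb = aa + stdv N ν) ∧ (dd = aa + stdv N μ ∨ dd = aa + stdv N ν) := by
  by_contra hcon
  push Not at hcon
  apply h
  rw [W, Finset.sum_eq_zero, Finset.sum_eq_zero, Finset.sum_eq_zero]
  · simp
  · intro μ _
    refine Finset.sum_eq_zero fun ν _ => if_neg ?_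
    rintro ⟨-, h1, h2, h3⟩
    exact (hcon μ ν h3 (Or.inr h1)).2 h2
  · intro μ _
    refine Finset.sum_eq_zero fun ν _ => if_neg ?_
    rintro ⟨-, h1, h2, h3⟩
    exact (hcon μ ν h3 (Or.inr h1)).1 h2
  · intro μ _
    refine if_neg ?_
    rintro ⟨h1, h2, h3⟩
    exact (hcon μ μ h3 (Or.inr h1)).1 h2

lemma W_supp (x : ℝ) (N r : ℕ) (dd bb a : Fin N → ℂ) (μ ν : Fin N) (u : ℂ)
    (h : W x N r (a + stdv N μ + stdv N ν) dd bb a u ≠ 0) :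
      (bb = a + stdv N μ ∨ bb = a + stdv N ν) ∧ (dd = a + stdv N μ ∨ dd = a + stdv N ν) := by
  obtain ⟨α, β, h1, h2, h3⟩ := W_supp0 x N r _ _ _ _ u h
  rcases stdv_add_inj N a μ ν α β h1 with ⟨rfl, rfl⟩ | ⟨rfl, rfl⟩
  · exact ⟨h2, h3⟩
  · exact ⟨h2.symm, h3.symm⟩

lemma W_off (x : ℝ) (N r : ℕ) (a : Fin N → ℂ) (μ ν : Fin N) (hne : μ ≠ ν) (u : ℂ) :
    W x N r (a + stdv N μ + stdv N ν) (a + stdv N μ) (a + stdv N ν) a u =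
      RW x N r u * ebr x r u * ebr x r (a μ - a ν - 1) /
          (ebr x r (u - 1) * ebr x r (a μ - a ν)) := by
  rw [W, Finset.sum_eq_zero, zero_add, Finset.sum_eq_single μ, Finset.sum_eq_single ν,
    if_pos ⟨hne, rfl, rfl, rfl⟩, add_eq_left]
  · refine Finset.sum_eq_zero fun α _ => Finset.sum_eq_zero fun β _ => if_neg ?_
    rintro ⟨-, h1, h2, -⟩
    rw [add_right_inj, stdv_inj] at h1 h2
    exact hne (h2.trans h1.symm)
  · intro β _ hβ
    refine if_neg ?_
    rintro ⟨-, h1, h2, -⟩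
    rw [add_right_inj, stdv_inj] at h1 h2
    exact hβ h1.symm
  · simp
  · intro α _ hα
    refine Finset.sum_eq_zero fun β _ => if_neg ?_
    rintro ⟨-, h1, h2, -⟩
    rw [add_right_inj, stdv_inj] at h1 h2
    exact hα h2.symm
  · simp
  · intro α _
    refine if_neg ?_
    rintro ⟨h1, h2, -⟩
    rw [add_right_inj, stdv_inj] at h1 h2
    exact hne (h2.trans h1.symm)

lemma W_same (x : ℝ) (N r : ℕ) (a : Fin N → ℂ) (μ ν : Fin N) (hne : μ ≠ ν) (u : ℂ) :
    W x N r (a + stdv N μ + stdv N ν) (a + stdv N ν) (a + stdv N ν) a u =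
      RW x N r u * ebr x r (u - (a μ - a ν)) * ebr x r 1 /
          (ebr x r (u - 1) * ebr x r (a μ - a ν)) := by
  rw [W, Finset.sum_eq_zero, Finset.sum_eq_zero, zero_add, zero_add,
    Finset.sum_eq_single μ, Finset.sum_eq_single ν, if_pos ⟨hne, rfl, rfl, rfl⟩]
  · intro β _ hβ
    refine if_neg ?_
    rintro ⟨-, h1, h2, -⟩
    rw [add_right_inj, stdv_inj] at h1 h2
    exact hβ h1.symm
  · simp
  · intro α _ hα
    refine Finset.sum_eq_zero fun β _ => if_neg ?_
    rintro ⟨h0, h1, h2, h3⟩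
    rw [add_right_inj, stdv_inj] at h1 h2
    rcases stdv_add_inj N a _ _ _ _ h3 with h | h
    · exact hα h.1
    · exact h0 (h.1.trans h1)
  · simp
  · intro α _
    refine Finset.sum_eq_zero fun β _ => if_neg ?_
    rintro ⟨h0, h1, h2, h3⟩
    rw [add_right_inj, stdv_inj] at h1 h2
    exact h0 (h2.symm.trans h1)
  · intro α _
    refine if_neg ?_
    rintro ⟨h1, h2, h3⟩
    rcases stdv_add_inj N a _ _ _ _ h3 with h | h
    · exact hne (h.1.symm.trans h.2)
    · exact hne (h.2.symm.trans h.1)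

lemma W_swap (x : ℝ) (N r : ℕ) (a dd bb : Fin N → ℂ) (μ ν : Fin N) (u : ℂ) :
    W x N r (a + stdv N μ + stdv N ν) dd bb a u = W x N r (a + stdv N ν + stdv N μ) dd bb a u := by
  rw [add_right_comm]

lemma KB_ne (x : ℝ) (N r : ℕ) (cb : ℝ) (hN : 0 < N) (top side bot : Fin N → ℂ) (u : ℂ)
    (h : top ≠ bot) : KB x N r cb hN top side bot u = 0 := by
  rw [KB]
  exact Finset.sum_eq_zero fun μ _ => if_neg fun h' => h h'.1

lemma KB_eq (x : ℝ) (N r : ℕ) (cb : ℝ) (hN : 0 < N) (a : Fin N → ℂ) (u : ℂ) : ∃ κ : ℂ,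
    ∀ μ : Fin N, KB x N r cb hN a (a + stdv N μ) a u =
      κ * (ebr x r (a ⟨0, hN⟩ - a μ + cb + u) / ebr x r (a ⟨0, hN⟩ - a μ + cb - u)) := by
  refine ⟨Complex.exp (2 * u *
          ((((r : ℂ) - 1) / (r : ℂ)) * (((N : ℂ) - 1) / (N : ℂ)) -
            (2 / (r : ℂ)) * a ⟨0, hN⟩) * Real.log x) *
        (hK x N r cb hN a (cxp x (2 * u)) / hK x N r cb hN a (cxp x (-2 * u))) *
        ebr x r ((cb : ℂ) - u) / ebr x r ((cb : ℂ) + u), fun μ => ?_⟩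
  rw [KB, Finset.sum_eq_single μ, if_pos ⟨rfl, rfl⟩]
  · exact (div_mul_div_comm _ _ _ _).symm
  · intro ν _ hν
    refine if_neg ?_
    rintro ⟨-, h⟩
    rw [add_right_inj, stdv_inj] at h
    exact hν h.symm
  · simp

/-- off-diagonal component of the reflection equation -/
lemma core_off (x : ℝ) (hx0 : 0 < x) (hx1 : x < 1) (N r : ℕ) (hr : 0 < r) (cb : ℝ) (hN : 0 < N)
    (a : Fin N → ℂ) (u v : ℂ) (μ ν : Fin N) (hne : μ ≠ ν)
    (hKa : ∀ μ : Fin N, ∀ s ∈ ({u, v} : Set ℂ), ebr x r (a ⟨0, hN⟩ - a μ + cb - s) ≠ 0) :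
    W x N r (a + stdv N μ + stdv N ν) (a + stdv N μ) (a + stdv N ν) a (u - v) *
      W x N r (a + stdv N μ + stdv N ν) (a + stdv N μ) (a + stdv N μ) a (u + v) *
      KB x N r cb hN a (a + stdv N μ) a u * KB x N r cb hN a (a + stdv N μ) a v +
    W x N r (a + stdv N μ + stdv N ν) (a + stdv N ν) (a + stdv N ν) a (u - v) *
      W x N r (a + stdv N μ + stdv N ν) (a + stdv N μ) (a + stdv N ν) a (u + v) *
      KB x N r cb hN a (a + stdv N ν) a u * KB x N r cb hN a (a + stdv N μ) a v =
    W x N r (a + stdv N μ + stdv N ν) (a + stdv N μ) (a + stdv N μ) a (u - v) *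
      W x N r (a + stdv N μ + stdv N ν) (a + stdv N μ) (a + stdv N ν) a (u + v) *
      KB x N r cb hN a (a + stdv N μ) a u * KB x N r cb hN a (a + stdv N ν) a v +
    W x N r (a + stdv N μ + stdv N ν) (a + stdv N μ) (a + stdv N ν) a (u - v) *
      W x N r (a + stdv N μ + stdv N ν) (a + stdv N ν) (a + stdv N ν) a (u + v) *
      KB x N r cb hN a (a + stdv N ν) a u * KB x N r cb hN a (a + stdv N ν) a v := by
  have hsame : ∀ s, W x N r (a + stdv N μ + stdv N ν) (a + stdv N μ) (a + stdv N μ) a s =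
      - (RW x N r s * ebr x r (s + (a μ - a ν)) * ebr x r 1 /
          (ebr x r (s - 1) * ebr x r (a μ - a ν))) := fun s => by
    rw [W_swap, W_same x N r a ν μ hne.symm, ← neg_sub (a μ), ebr_neg x hx0 hx1 r hr, sub_neg_eq_add,
      mul_neg, div_neg]
  rw [hsame, hsame, W_off x N r a μ ν hne, W_off x N r a μ ν hne, W_same x N r a μ ν hne,
    W_same x N r a μ ν hne]
  obtain ⟨κu, hu⟩ := KB_eq x N r cb hN a u
  obtain ⟨κv, hv⟩ := KB_eq x N r cb hN a v
  rw [hu, hu, hv, hv]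
  have n1 := hKa μ u (by simp)
  have n2 := hKa ν u (by simp)
  have n3 := hKa μ v (by simp)
  have n4 := hKa ν v (by simp)
  have key := six_term x hx0 hx1 r hr u v (a ⟨0, hN⟩ - a μ + cb) (a ⟨0, hN⟩ - a ν + cb)
  rw [show (a ⟨0, hN⟩ - a ν + cb) - (a ⟨0, hN⟩ - a μ + cb) = a μ - a ν by ring] at key
  generalize a ⟨0, hN⟩ - a μ + (cb : ℂ) = X at *
  generalize a ⟨0, hN⟩ - a ν + (cb : ℂ) = Y at *
  generalize a μ - a ν = α at *
  have key2 : ebr x r (u + v) * (ebr x r (u - v - α) * (ebr x r (X + v) / ebr x r (X - v)) *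
        (ebr x r (Y + u) / ebr x r (Y - u)) +
      ebr x r (u - v + α) * (ebr x r (X + u) / ebr x r (X - u)) *
        (ebr x r (Y + v) / ebr x r (Y - v))) =
    ebr x r (u - v) * (ebr x r (u + v + α) * (ebr x r (X + v) / ebr x r (X - v)) *
        (ebr x r (X + u) / ebr x r (X - u)) +
      ebr x r (u + v - α) * (ebr x r (Y + u) / ebr x r (Y - u)) *
        (ebr x r (Y + v) / ebr x r (Y - v))) := by
    field_simp
    linear_combination key
  simp only [div_eq_mul_inv, mul_inv] at *
  linear_combination (RW x N r (u - v) * RW x N r (u + v) * κu * κv * ebr x r (α - 1) * ebr x r 1 *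
    (ebr x r (u - v - 1))⁻¹ * (ebr x r (u + v - 1))⁻¹ * (ebr x r α)⁻¹ ^ 2) * key2

lemma core_diag (x : ℝ) (hx0 : 0 < x) (hx1 : x < 1) (N r : ℕ) (hr : 0 < r)
    (a : Fin N → ℂ) (s t : ℂ) (μ ν : Fin N) (hne : μ ≠ ν) :
    W x N r (a + stdv N μ + stdv N ν) (a + stdv N ν) (a + stdv N μ) a s *
      W x N r (a + stdv N μ + stdv N ν) (a + stdv N μ) (a + stdv N ν) a t =
    W x N r (a + stdv N μ + stdv N ν) (a + stdv N μ) (a + stdv N ν) a s *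
      W x N r (a + stdv N μ + stdv N ν) (a + stdv N ν) (a + stdv N μ) a t := by
  have h : ∀ s, W x N r (a + stdv N μ + stdv N ν) (a + stdv N ν) (a + stdv N μ) a s =
      RW x N r s * ebr x r s * ebr x r (a ν - a μ - 1) /
          (ebr x r (s - 1) * ebr x r (a ν - a μ)) := fun s => by
    rw [W_swap, W_off x N r a ν μ hne.symm]
  rw [h, h, W_off x N r a μ ν hne, W_off x N r a μ ν hne]
  simp only [div_eq_mul_inv, mul_inv]
  ring

lemma finsum_two {N : ℕ} (F : (Fin N → ℂ) → ℂ) (p q : Fin N → ℂ) (hpq : p ≠ q)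
    (h : ∀ f, F f ≠ 0 → f = p ∨ f = q) : ∑ᶠ f, F f = F p + F q := by
  rw [finsum_eq_sum_of_support_subset F (s := {p, q}), Finset.sum_pair hpq]
  intro f hf
  simpa using h f hf

lemma finsum_onept {N : ℕ} (F : (Fin N → ℂ) → ℂ) (p : Fin N → ℂ)
    (h : ∀ f, F f ≠ 0 → f = p) : ∑ᶠ f, F f = F p :=
  finsum_eq_single F p fun f hf => by
    by_contra hc
    exact hf (h f hc)

lemma reduced (x : ℝ) (hx0 : 0 < x) (hx1 : x < 1) (N r : ℕ) (hr : 0 < r) (cb : ℝ) (hN : 0 < N)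
    (a b c d : Fin N → ℂ) (u v : ℂ)
    (hKa : ∀ μ : Fin N, ∀ s ∈ ({u, v} : Set ℂ), ebr x r (a ⟨0, hN⟩ - a μ + cb - s) ≠ 0) :
    (∑ᶠ f : Fin N → ℂ, W x N r c f b a (u - v) * W x N r c d f a (u + v) *
          KB x N r cb hN a f a u * KB x N r cb hN a d a v) =
    ∑ᶠ f : Fin N → ℂ, W x N r c d f a (u - v) * W x N r c f b a (u + v) *
          KB x N r cb hN a f a u * KB x N r cb hN a b a v := by
  -- terms vanish off the admissible configurations
  by_cases hc : ∃ μ ν : Fin N, c = a + stdv N μ + stdv N ν ∧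
      (b = a + stdv N μ ∨ b = a + stdv N ν) ∧ (d = a + stdv N μ ∨ d = a + stdv N ν)
  swap
  · have key : ∀ f s t, W x N r c f b a s * W x N r c d f a t = 0 := by
      intro f s t
      by_contra hh
      obtain ⟨μ, ν, h1, h2, h3⟩ := W_supp0 x N r _ _ _ _ _ (left_ne_zero_of_mul hh)
      have h4 := right_ne_zero_of_mul hh
      subst h1
      exact hc ⟨μ, ν, rfl, h2, (W_supp x N r _ _ a μ ν t h4).2⟩
    have z1 : ∀ f, W x N r c f b a (u - v) * W x N r c d f a (u + v) *
          KB x N r cb hN a f a u * KB x N r cb hN a d a v = 0 := fun f => by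
      rw [key]; ring
    have z2 : ∀ f, W x N r c d f a (u - v) * W x N r c f b a (u + v) *
          KB x N r cb hN a f a u * KB x N r cb hN a b a v = 0 := fun f => by
      rw [mul_comm (W x N r c d f a _), key]; ring
    simp only [z1, z2]
  obtain ⟨μ, ν, rfl, hb, hd⟩ := hc
  by_cases hne : μ = ν
  · subst hne
    rw [or_self] at hb hd
    subst hb hd
    rw [finsum_onept _ (a + stdv N μ), finsum_onept _ (a + stdv N μ)]
    · intro f hf
      have := W_supp x N r _ _ a μ μ _ (left_ne_zero_of_mul (left_ne_zero_of_mul (left_ne_zero_of_mul hf)))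
      simpa using this.1
    · intro f hf
      have := W_supp x N r _ _ a μ μ _ (left_ne_zero_of_mul (left_ne_zero_of_mul (left_ne_zero_of_mul hf)))
      simpa using this.2
  have hpq : a + stdv N μ ≠ a + stdv N ν := by
    rw [Ne, add_right_inj, stdv_inj]; exact hne
  rw [finsum_two _ _ _ hpq, finsum_two _ _ _ hpq]
  rotate_left
  · intro f hf
    exact (W_supp x N r _ _ a μ ν _ (left_ne_zero_of_mul (left_ne_zero_of_mul (left_ne_zero_of_mul hf)))).1
  · intro f hf
    exact (W_supp x N r _ _ a μ ν _ (left_ne_zero_of_mul (left_ne_zero_of_mul (left_ne_zero_of_mul hf)))).2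
  have hdg := core_diag x hx0 hx1 N r hr a (u - v) (u + v) μ ν hne
  rcases hb with rfl | rfl <;> rcases hd with rfl | rfl
  · linear_combination (KB x N r cb hN a (a + stdv N ν) a u * KB x N r cb hN a (a + stdv N μ) a v) * hdg
  · have := core_off x hx0 hx1 N r hr cb hN a u v ν μ (Ne.symm hne) hKa
    simp only [W_swap x N r a _ _ ν μ] at this
    linear_combination this
  · have := core_off x hx0 hx1 N r hr cb hN a u v μ ν hne hKa
    linear_combination this
  · linear_combination -(KB x N r cb hN a (a + stdv N μ) a u * KB x N r cb hN a (a + stdv N ν) a v) * hdg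

/-- The boundary Yang–Baxter (reflection) equation. -/
theorem boundary_yang_baxter (x : ℝ) (hx0 : 0 < x) (hx1 : x < 1)
    (N r : ℕ) (hN : 2 ≤ N) (hr : N + 2 ≤ r)
    (cb : ℝ) (hcb0 : 0 < cb) (hcb1 : cb < 1)
    (a b c d e : Fin N → ℂ) (u v : ℂ)
    (h1 : ebr x r (u - v - 1) ≠ 0) (h2 : ebr x r (u + v - 1) ≠ 0)
    (h3 : ebr x r ((cb : ℂ) + u) ≠ 0) (h4 : ebr x r ((cb : ℂ) + v) ≠ 0)
    (ha : ∀ μ ν : Fin N, μ ≠ ν → ebr x r (a μ - a ν) ≠ 0)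
    (he : ∀ μ ν : Fin N, μ ≠ ν → ebr x r (e μ - e ν) ≠ 0)
    (hKa : ∀ μ : Fin N, ∀ s ∈ ({u, v} : Set ℂ),
      ebr x r (a ⟨0, by omega⟩ - a μ + cb - s) ≠ 0)
    (hKe : ∀ μ : Fin N, ∀ s ∈ ({u, v} : Set ℂ),
      ebr x r (e ⟨0, by omega⟩ - e μ + cb - s) ≠ 0)
    (hha : ∀ s ∈ ({cxp x (2 * u), cxp x (-2 * u), cxp x (2 * v), cxp x (-2 * v)} : Set ℂ),
      hK x N r cb (by omega) a s ≠ 0 ∧ hK x N r cb (by omega) e s ≠ 0) :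
    (∑ᶠ f : Fin N → ℂ, ∑ᶠ g : Fin N → ℂ,
        W x N r c f b a (u - v) * W x N r c d f g (u + v) *
          KB x N r cb (by omega) g f a u * KB x N r cb (by omega) e d g v)
    = ∑ᶠ f : Fin N → ℂ, ∑ᶠ g : Fin N → ℂ,
        W x N r c d f e (u - v) * W x N r c f b g (u + v) *
          KB x N r cb (by omega) e f g u * KB x N r cb (by omega) g b a v := by
  have hN0 : 0 < N := by omega
  have hr0 : 0 < r := by omega
  by_cases hea : e = a
  · subst hea
    have i1 : ∀ f, (∑ᶠ g : Fin N → ℂ,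
        W x N r c f b e (u - v) * W x N r c d f g (u + v) *
          KB x N r cb hN0 g f e u * KB x N r cb hN0 e d g v) =
        W x N r c f b e (u - v) * W x N r c d f e (u + v) *
          KB x N r cb hN0 e f e u * KB x N r cb hN0 e d e v := fun f =>
      finsum_eq_single _ e fun g hg => by rw [KB_ne x N r cb hN0 g f e u hg]; ring
    have i2 : ∀ f, (∑ᶠ g : Fin N → ℂ,
        W x N r c d f e (u - v) * W x N r c f b g (u + v) *
          KB x N r cb hN0 e f g u * KB x N r cb hN0 g b e v) =
        W x N r c d f e (u - v) * W x N r c f b e (u + v) *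
          KB x N r cb hN0 e f e u * KB x N r cb hN0 e b e v := fun f =>
      finsum_eq_single _ e fun g hg => by rw [KB_ne x N r cb hN0 g b e v hg]; ring
    rw [finsum_congr i1, finsum_congr i2]
    exact reduced x hx0 hx1 N r hr0 cb hN0 e b c d u v hKa
  · have z1 : ∀ f g : Fin N → ℂ,
        W x N r c f b a (u - v) * W x N r c d f g (u + v) *
          KB x N r cb hN0 g f a u * KB x N r cb hN0 e d g v = 0 := fun f g => by
      by_cases hg : g = a
      · rw [KB_ne x N r cb hN0 e d g v (by rw [hg]; exact hea)]; ring
      · rw [KB_ne x N r cb hN0 g f a u hg]; ring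
    have z2 : ∀ f g : Fin N → ℂ,
        W x N r c d f e (u - v) * W x N r c f b g (u + v) *
          KB x N r cb hN0 e f g u * KB x N r cb hN0 g b a v = 0 := fun f g => by
      by_cases hg : g = a
      · rw [KB_ne x N r cb hN0 e f g u (by rw [hg]; exact hea)]; ring
      · rw [KB_ne x N r cb hN0 g b a v hg]; ring
    rw [finsum_congr fun f => finsum_congr (z1 f), finsum_congr fun f => finsum_congr (z2 f)]
end
end

section
/- Let μ ≥ 2 be an integer, c ∈ ℝ, and π_1, …, π_μ ∈ ℝ; write π_{i,j} = π_i − π_j (so π_{1,1} = 0) and q = x^{2r}. For 1 ≤ j ≤ μ−1 define g_j(w) = (1 − w^{−2})·(x^{2π_{1,j}+2c+2−j}/w;q)_∞·(x^{−2π_{1,j+1}+2r−2c+j}/w;q)_∞ / ((x^{2r−2π_{1,j}−2c−2+j}/w;q)_∞·(x^{2c+2π_{1,j+1}−j}/w;q)_∞), and for z, w_1, …, w_{μ−1} ∈ ℂ∖{0} set E(z; w_1,…,w_{μ−1}) = (∏_{j=1}^{μ−1} g_j(w_j))·w_{μ−1}·(∏_{j=2}^{μ−1} Θ_q(x·w_{j−1}·w_j)·Θ_q(x^{2π_{j,μ}−1}·w_{j−1}/w_j))·[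 z·Θ_q(x^{2c}/z)·Θ_q(x^{2π_{1,μ}+2c}·z)·Θ_q(x^{2π_{1,μ}−1}/(z·w_1))·Θ_q(x·w_1/z) − z^{−1}·Θ_q(x^{2c}·z)·Θ_q(x^{2π_{1,μ}+2c}/z)·Θ_q(x^{2π_{1,μ}−1}·z/w_1)·Θ_q(x·z·w_1) ]. Then for all z, w_1, …, w_{μ−1} at which all factors are defined: Σ_{(ε_1,…,ε_{μ−1}) ∈ {±1}^{μ−1}} E(z; w_1^{ε_1}, …, w_{μ−1}^{ε_{μ−1}}) = 0 (the weak equality E ∼_{(w_1,…,w_{μ−1})} 0). -/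
noncomputable section

/-- `g_j(w)` of the paper, with dynamical parameters `π_1, …, π_μ`
(`π_{i,j} := π i - π j`). -/
def gB (x r c : ℝ) (π : ℕ → ℝ) (j : ℕ) (v : ℂ) : ℂ :=
  (1 - (v⁻¹) ^ 2) *
    qpoch (cxp x (2 * (π 1 - π j) + 2 * c + 2 - j) / v) (cxp x (2 * r)) *
    qpoch (cxp x (-2 * (π 1 - π (j + 1)) + 2 * r - 2 * c + j) / v) (cxp x (2 * r)) /
  (qpoch (cxp x (2 * r - 2 * (π 1 - π j) - 2 * c - 2 + j) / v) (cxp x (2 * r)) *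
    qpoch (cxp x (2 * c + 2 * (π 1 - π (j + 1)) - j) / v) (cxp x (2 * r)))

/-- The expression `E(z; w_1, …, w_{μ-1})` of the paper. -/
def Ebig (x r c : ℝ) (π : ℕ → ℝ) (μ : ℕ) (z : ℂ) (w : ℕ → ℂ) : ℂ :=
  (∏ j ∈ Finset.Icc 1 (μ - 1), gB x r c π j (w j)) * w (μ - 1) *
  (∏ j ∈ Finset.Icc 2 (μ - 1),
    jtheta (cxp x (2 * r)) ((x : ℂ) * w (j - 1) * w j) *
      jtheta (cxp x (2 * r)) (cxp x (2 * (π j - π μ) - 1) * w (j - 1) / w j)) *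
  ( z * jtheta (cxp x (2 * r)) (cxp x (2 * c) / z) *
      jtheta (cxp x (2 * r)) (cxp x (2 * (π 1 - π μ) + 2 * c) * z) *
      jtheta (cxp x (2 * r)) (cxp x (2 * (π 1 - π μ) - 1) / (z * w 1)) *
      jtheta (cxp x (2 * r)) ((x : ℂ) * w 1 / z)
    - z⁻¹ * jtheta (cxp x (2 * r)) (cxp x (2 * c) * z) *
      jtheta (cxp x (2 * r)) (cxp x (2 * (π 1 - π μ) + 2 * c) / z) *
      jtheta (cxp x (2 * r)) (cxp x (2 * (π 1 - π μ) - 1) * z / w 1) *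
      jtheta (cxp x (2 * r)) ((x : ℂ) * z * w 1) )

/-! ### Finite form of the Jacobi triple product -/

/-- Coefficients of `∏_{k<N} (1 - y q^k)`. -/
def qc (q : ℂ) : ℕ → ℕ → ℂ
  | 0, 0 => 1
  | 0, _ + 1 => 0
  | _ + 1, 0 => 1
  | N + 1, k + 1 => qc q N (k + 1) - q ^ N * qc q N k

lemma qc_zero (q : ℂ) (N : ℕ) : qc q N 0 = 1 := by cases N <;> simp [qc]

lemma qc_gt (q : ℂ) (N : ℕ) : ∀ k, N < k → qc q N k = 0 := by
  induction N with
  | zero => intro k hk; obtain ⟨k, rfl⟩ := Nat.exists_eq_succ_of_ne_zero hk.ne'; simp [qc]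
  | succ N ih =>
    intro k hk
    obtain ⟨k, rfl⟩ := Nat.exists_eq_succ_of_ne_zero (by omega : k ≠ 0)
    simp only [qc]
    rw [ih _ (by omega), ih _ (by omega)]; simp

lemma prod_eq_qc (q y : ℂ) (N : ℕ) :
    ∏ k ∈ Finset.range N, (1 - y * q ^ k) = ∑ i ∈ Finset.range (N + 1), qc q N i * y ^ i := by
  induction N with
  | zero => simp [qc]
  | succ N ih =>
    rw [Finset.prod_range_succ, ih, Finset.sum_range_succ' _ (N + 1)]
    have h1 : ∑ i ∈ Finset.range (N + 1), qc q N i * y ^ i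
        = ∑ i ∈ Finset.range (N + 1), qc q N (i + 1) * y ^ (i + 1) + 1 := by
      have h := Finset.sum_range_succ' (fun i => qc q N i * y ^ i) (N + 1)
      rw [Finset.sum_range_succ _ (N + 1), qc_gt q N (N + 1) (by omega)] at h
      simpa [qc_zero] using h
    have h2 : ∑ i ∈ Finset.range (N + 1), qc q (N + 1) (i + 1) * y ^ (i + 1)
        = ∑ i ∈ Finset.range (N + 1), qc q N (i + 1) * y ^ (i + 1)
          - y * q ^ N * ∑ i ∈ Finset.range (N + 1), qc q N i * y ^ i := by
      rw [Finset.mul_sum, ← Finset.sum_sub_distrib]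
      refine Finset.sum_congr rfl fun i _ => ?_
      simp only [qc]; ring
    rw [h2, qc_zero, pow_zero, mul_one, mul_sub, mul_one]
    nth_rewrite 1 [h1]
    ring

/-- `(q;q)_m`. -/
def qF (q : ℂ) (m : ℕ) : ℂ := ∏ k ∈ Finset.range m, (1 - q * q ^ k)

lemma qF_succ (q : ℂ) (m : ℕ) : qF q (m + 1) = qF q m * (1 - q * q ^ m) := by
  simp [qF, Finset.prod_range_succ]

lemma qc_formula (q : ℂ) (N : ℕ) : ∀ a b, a + b = N →
    qc q N a * (qF q a * qF q b) = (-1) ^ a * q ^ (a.choose 2) * qF q N := by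
  induction N with
  | zero =>
    intro a b h
    obtain ⟨rfl, rfl⟩ : a = 0 ∧ b = 0 := by omega
    simp [qc, qF]
  | succ N ih =>
    intro a b h
    rcases a with _ | a
    · obtain rfl : b = N + 1 := by omega
      simp [qc, qF]
    have e : (a + 1).choose 2 = a + a.choose 2 := by
      rw [Nat.choose_succ_succ' a 1]; simp
    rcases b with _ | b
    · obtain rfl : a = N := by omega
      have h1 := ih a 0 (by omega)
      simp only [qc, qc_gt q a (a + 1) (by omega), e, qF_succ, pow_add, pow_one]
      linear_combination (-q ^ a * (1 - q * q ^ a)) * h1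
    · have h1 := ih (a + 1) b (by omega)
      have h2 := ih a (b + 1) (by omega)
      obtain rfl : N = a + b + 1 := by omega
      have hq : qc q (a + b + 1 + 1) (a + 1)
          = qc q (a + b + 1) (a + 1) - q ^ (a + b + 1) * qc q (a + b + 1) a := by rw [qc]
      rw [hq, qF_succ q (a + b + 1)]
      rw [e] at h1 ⊢
      rw [qF_succ] at h1 h2 ⊢
      rw [qF_succ q b]
      simp only [pow_add, pow_one] at h1 h2 ⊢
      linear_combination (1 - q * q ^ b) * h1 - q ^ a * q ^ b * q * (1 - q * q ^ a) * h2

/-- General term of the theta series (`q = s²`). -/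
def tT (s z : ℂ) (j : ℤ) : ℂ := (-1) ^ j * s ^ (j * (j - 1)) * z ^ j

lemma choose_two_pow (s : ℂ) (hs : s ≠ 0) (a : ℕ) :
    (s ^ 2) ^ (a.choose 2) = s ^ ((a : ℤ) * (a - 1)) := by
  induction a with
  | zero => simp
  | succ a ih =>
    rw [Nat.choose_succ_succ' a 1, pow_add, ih, Nat.choose_one_right, ← pow_mul,
      ← zpow_natCast s, ← zpow_add₀ hs]
    congr 1; push_cast; ring

lemma tri_pow (s z : ℂ) (hs : s ≠ 0) (hz : z ≠ 0) (n : ℕ) :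
    ∏ k ∈ Finset.range n, (1 - z * ((s ^ 2) ^ n)⁻¹ * (s ^ 2) ^ k)
      = (-z) ^ n * s ^ (-(n : ℤ) * (n + 1)) *
        ∏ k ∈ Finset.range n, (1 - s ^ 2 / z * (s ^ 2) ^ k) := by
  have key : ∀ n : ℕ, ∏ k ∈ Finset.range n, (1 - z * ((s ^ 2) ^ (k + 1))⁻¹)
      = (-z) ^ n * s ^ (-(n : ℤ) * (n + 1)) *
        ∏ k ∈ Finset.range n, (1 - s ^ 2 / z * (s ^ 2) ^ k) := by
    intro n
    induction n with
    | zero => simp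
    | succ n ih =>
      rw [Finset.prod_range_succ, Finset.prod_range_succ, ih]
      have : s ^ (-((n + 1 : ℕ) : ℤ) * ((n + 1 : ℕ) + 1))
          = s ^ (-(n : ℤ) * (n + 1)) * ((s ^ 2) ^ (n + 1))⁻¹ := by
        rw [← pow_mul, ← zpow_natCast s, ← zpow_neg, ← zpow_add₀ hs]
        congr 1; push_cast; ring
      rw [this]
      have h3 : (1 - z * ((s ^ 2) ^ (n + 1))⁻¹)
        = (-z) * ((s ^ 2) ^ (n + 1))⁻¹ * (1 - s ^ 2 / z * (s ^ 2) ^ n) := by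
        field_simp; ring
      rw [h3]; ring
  rw [← key, ← Finset.prod_range_reflect]
  refine Finset.prod_congr rfl fun k hk => ?_
  have hk := Finset.mem_range.1 hk
  have : (s ^ 2) ^ n = (s ^ 2) ^ (n - 1 - k) * (s ^ 2) ^ (k + 1) := by
    rw [← pow_add]; congr 1; omega
  rw [this]; field_simp

/-- Truncated weights. -/
def tG (q : ℂ) (n : ℕ) (j : ℤ) : ℂ :=
  if j ∈ Finset.Icc (-(n : ℤ)) n then
    qF q (2 * n) / (qF q (n + j).toNat * qF q (n - j).toNat) else 0

lemma finite_triple_s12 (s z : ℂ) (hs : s ≠ 0) (hz : z ≠ 0) (hF : ∀ m, qF (s ^ 2) m ≠ 0) (n : ℕ) :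
    (∏ k ∈ Finset.range n, (1 - z * (s ^ 2) ^ k)) *
      ∏ k ∈ Finset.range n, (1 - s ^ 2 / z * (s ^ 2) ^ k)
      = ∑' j : ℤ, tT s z j * tG (s ^ 2) n j := by
  rw [tsum_eq_sum (s := Finset.Icc (-(n : ℤ)) n) (by intro j hj; simp [tG, hj])]
  have h0 := prod_eq_qc (s ^ 2) (z * ((s ^ 2) ^ n)⁻¹) (2 * n)
  rw [two_mul, Finset.prod_range_add, tri_pow s z hs hz] at h0
  have h1 : ∏ k ∈ Finset.range n, (1 - z * ((s ^ 2) ^ n)⁻¹ * (s ^ 2) ^ (n + k))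
      = ∏ k ∈ Finset.range n, (1 - z * (s ^ 2) ^ k) := by
    refine Finset.prod_congr rfl fun k _ => ?_
    rw [pow_add]; field_simp
  rw [h1] at h0
  have h2 : ∑ j ∈ Finset.Icc (-(n : ℤ)) n, tT s z j * tG (s ^ 2) n j
      = ∑ i ∈ Finset.range (n + n + 1), tT s z ((i : ℤ) - n) * tG (s ^ 2) n ((i : ℤ) - n) := by
    symm
    refine Finset.sum_bij (fun i _ => (i : ℤ) - n) ?_ ?_ ?_ ?_
    · intro i hi; simp only [Finset.mem_range, Finset.mem_Icc] at *; omega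
    · intro i _ j _ h; omega
    · intro j hj; simp only [Finset.mem_Icc] at hj
      exact ⟨(j + n).toNat, by simp only [Finset.mem_range]; omega, by omega⟩
    · intro i _; rfl
  rw [h2]
  have h3 : ∑ i ∈ Finset.range (n + n + 1), qc (s ^ 2) (n + n) i * (z * ((s ^ 2) ^ n)⁻¹) ^ i
      = (-z) ^ n * s ^ (-(n : ℤ) * (n + 1)) *
       ∑ i ∈ Finset.range (n + n + 1), tT s z ((i : ℤ) - n) * tG (s ^ 2) n ((i : ℤ) - n) := by
    rw [Finset.mul_sum]
    refine Finset.sum_congr rfl fun i hi => ?_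
    have hi := Finset.mem_range.1 hi
    have f := qc_formula (s ^ 2) (n + n) i (n + n - i) (by omega)
    rw [← eq_div_iff (mul_ne_zero (hF _) (hF _))] at f
    rw [f, choose_two_pow s hs, tG, if_pos (by simp only [Finset.mem_Icc]; omega)]
    have e1 : ((n : ℤ) + (i - n)).toNat = i := by omega
    have e2 : ((n : ℤ) - (i - n)).toNat = n + n - i := by omega
    rw [e1, e2, two_mul, tT]
    have e3 : ((-1 : ℂ)) ^ ((i : ℤ) - n) = (-1) ^ i * (-1) ^ n := by
      rw [zpow_sub₀ (by norm_num), zpow_natCast, zpow_natCast, div_eq_mul_inv, ← inv_pow]; norm_num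
    have e4 : (-z) ^ n * ((-1 : ℂ) ^ n * z ^ ((i : ℤ) - n)) = z ^ i := by
      rw [zpow_sub₀ hz, zpow_natCast, zpow_natCast, neg_pow]
      have : ((-1 : ℂ) ^ n) * (-1) ^ n = 1 := by rw [← mul_pow]; norm_num
      field_simp
      linear_combination this
    have e5 : s ^ ((i : ℤ) * (i - 1)) * (((s ^ 2) ^ n)⁻¹) ^ i
        = s ^ (-(n : ℤ) * (n + 1)) * s ^ (((i : ℤ) - n) * (i - n - 1)) := by
      rw [← pow_mul, ← inv_pow, ← pow_mul, inv_pow, ← zpow_natCast s, ← zpow_neg, ← zpow_add₀ hs, ← zpow_add₀ hs]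
      congr 1; push_cast; ring
    rw [e3, mul_pow, ← e4]
    linear_combination ((-1) ^ i * qF (s ^ 2) (n + n) / (qF (s ^ 2) i * qF (s ^ 2) (n + n - i)) * ((-z) ^ n * ((-1 : ℂ) ^ n * z ^ ((i : ℤ) - n)))) * e5
  rw [h3, mul_assoc] at h0
  have hne : (-z) ^ n * s ^ (-(n : ℤ) * (n + 1)) ≠ 0 :=
    mul_ne_zero (pow_ne_zero _ (neg_ne_zero.2 hz)) (zpow_ne_zero _ hs)
  have h4 := mul_left_cancel₀ hne h0
  rw [← h4, mul_comm]

/-! ### Jacobi triple product -/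

lemma summable_gauss_nat (ρ R : ℝ) (h0 : 0 < ρ) (h1 : ρ < 1) (hR : 0 < R) :
    Summable (fun n : ℕ => ρ ^ ((n : ℤ) * n) * R ^ (n : ℤ)) := by
  have ht : Filter.Tendsto (fun n : ℕ => ρ ^ n * R) Filter.atTop (nhds (0 * R)) :=
    (tendsto_pow_atTop_nhds_zero_of_lt_one h0.le h1).mul_const R
  rw [zero_mul] at ht
  have he : ∀ᶠ n : ℕ in Filter.atTop, ρ ^ n * R < 1 / 2 := ht.eventually (gt_mem_nhds (by norm_num))
  refine Summable.of_norm_bounded_eventually_nat (g := fun n => (1 / 2 : ℝ) ^ n)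
    (summable_geometric_of_lt_one (by norm_num) (by norm_num)) ?_
  filter_upwards [he] with n hn
  have : ρ ^ ((n : ℤ) * n) * R ^ (n : ℤ) = (ρ ^ n * R) ^ n := by
    rw [mul_pow, ← pow_mul, zpow_natCast]; norm_cast
  rw [this, Real.norm_of_nonneg (by positivity)]
  exact pow_le_pow_left₀ (by positivity) hn.le n

lemma summable_gauss (ρ R : ℝ) (h0 : 0 < ρ) (h1 : ρ < 1) (hR : 0 < R) :
    Summable (fun n : ℤ => ρ ^ (n * n) * R ^ n) := by
  refine Summable.of_nat_of_neg (summable_gauss_nat ρ R h0 h1 hR) ?_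
  have := summable_gauss_nat ρ R⁻¹ h0 h1 (inv_pos.2 hR)
  refine this.congr fun n => ?_
  simp

lemma summable_tT (s z : ℂ) (hs : s ≠ 0) (hs1 : ‖s‖ < 1) (hz : z ≠ 0) :
    Summable (fun j : ℤ => ‖tT s z j‖) := by
  have h := summable_gauss ‖s‖ (‖z‖ / ‖s‖) (norm_pos_iff.2 hs) hs1 (by positivity)
  refine h.congr fun j => ?_
  have : ‖s‖ ≠ 0 := norm_ne_zero_iff.2 hs
  rw [tT, norm_mul, norm_mul, norm_zpow, norm_zpow, norm_zpow, norm_neg, norm_one, one_zpow,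
    one_mul, div_zpow, mul_sub, mul_one, zpow_sub₀ this]
  field_simp

lemma summable_qp (z q : ℂ) (hq : ‖q‖ < 1) : Summable (fun n : ℕ => ‖-(z * q ^ n)‖) := by
  simp only [norm_neg, norm_mul, norm_pow]
  exact (summable_geometric_of_lt_one (norm_nonneg _) hq).mul_left _

lemma tendsto_qpoch (z q : ℂ) (hq : ‖q‖ < 1) :
    Filter.Tendsto (fun n => ∏ k ∈ Finset.range n, (1 - z * q ^ k)) Filter.atTop
      (nhds (qpoch z q)) := by
  have h : Multipliable (fun n : ℕ => 1 + -(z * q ^ n)) :=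
    multipliable_one_add_of_summable (summable_qp z q hq)
  simp only [← sub_eq_add_neg] at h
  exact h.hasProd.tendsto_prod_nat

lemma one_sub_ne (q : ℂ) (hq : ‖q‖ < 1) (k : ℕ) : 1 - q * q ^ k ≠ 0 := by
  intro h
  have h1 : q ^ (k + 1) = 1 := by rw [pow_succ']; exact (sub_eq_zero.1 h).symm
  have h2 : ‖q‖ ^ (k + 1) = 1 := by rw [← norm_pow, h1, norm_one]
  have h3 : ‖q‖ ^ (k + 1) < 1 := pow_lt_one₀ (norm_nonneg _) hq (by omega)
  linarith

lemma qpoch_self_ne (q : ℂ) (hq : ‖q‖ < 1) : qpoch q q ≠ 0 := by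
  have := tprod_one_add_ne_zero_of_summable (f := fun n : ℕ => -(q * q ^ n))
    (fun n => by rw [← sub_eq_add_neg]; exact one_sub_ne q hq n) (summable_qp q q hq)
  simp only [← sub_eq_add_neg] at this
  exact this

lemma triple_product_s12 (s z : ℂ) (hs : s ≠ 0) (hs1 : ‖s‖ < 1) (hz : z ≠ 0) :
    jtheta (s ^ 2) z = ∑' j : ℤ, tT s z j := by
  have hq : ‖s ^ 2‖ < 1 := by rw [norm_pow]; exact pow_lt_one₀ (norm_nonneg _) hs1 (by norm_num)
  have hF : ∀ m, qF (s ^ 2) m ≠ 0 := fun m => Finset.prod_ne_zero_iff.2 fun k _ => one_sub_ne _ hq k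
  have hQ := qpoch_self_ne _ hq
  have tF : Filter.Tendsto (qF (s ^ 2)) Filter.atTop (nhds (qpoch (s ^ 2) (s ^ 2))) :=
    tendsto_qpoch _ _ hq
  have tFi := tF.inv₀ hQ
  obtain ⟨M, hM⟩ := (Metric.isBounded_range_of_tendsto _ tF).exists_norm_le
  obtain ⟨M', hM'⟩ := (Metric.isBounded_range_of_tendsto _ tFi).exists_norm_le
  have hM : ∀ m, ‖qF (s ^ 2) m‖ ≤ M := fun m => hM _ ⟨m, rfl⟩
  have hM' : ∀ m, ‖(qF (s ^ 2) m)⁻¹‖ ≤ M' := fun m => hM' _ ⟨m, rfl⟩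
  have hM0 : 0 ≤ M := (norm_nonneg _).trans (hM 0)
  have hM0' : 0 ≤ M' := (norm_nonneg _).trans (hM' 0)
  have lim1 : Filter.Tendsto (fun n => ∑' j : ℤ, tT s z j * tG (s ^ 2) n j) Filter.atTop
      (nhds (∑' j : ℤ, tT s z j * (qpoch (s ^ 2) (s ^ 2))⁻¹)) := by
    refine tendsto_tsum_of_dominated_convergence
      (bound := fun j => ‖tT s z j‖ * (M * (M' * M'))) ((summable_tT s z hs hs1 hz).mul_right _) ?_ ?_
    · intro j
      refine Filter.Tendsto.const_mul _ ?_
      have t1 : Filter.Tendsto (fun n : ℕ => 2 * n) Filter.atTop Filter.atTop :=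
        Filter.tendsto_atTop_mono (fun n => by simp only [id]; omega) Filter.tendsto_id
      have t2 : Filter.Tendsto (fun n : ℕ => ((n : ℤ) + j).toNat) Filter.atTop Filter.atTop := by
        refine Filter.tendsto_atTop.2 fun b => ?_
        filter_upwards [Filter.eventually_ge_atTop (b + j.natAbs)] with n hn
        omega
      have t3 : Filter.Tendsto (fun n : ℕ => ((n : ℤ) - j).toNat) Filter.atTop Filter.atTop := by
        refine Filter.tendsto_atTop.2 fun b => ?_
        filter_upwards [Filter.eventually_ge_atTop (b + j.natAbs)] with n hn
        omega
      have t4 := (tF.comp t1).div ((tF.comp t2).mul (tF.comp t3)) (mul_ne_zero hQ hQ)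
      have e : qpoch (s ^ 2) (s ^ 2) / (qpoch (s ^ 2) (s ^ 2) * qpoch (s ^ 2) (s ^ 2))
          = (qpoch (s ^ 2) (s ^ 2))⁻¹ := by field_simp
      rw [e] at t4
      refine t4.congr' ?_
      filter_upwards [Filter.eventually_ge_atTop j.natAbs] with n hn
      rw [tG, if_pos (by simp only [Finset.mem_Icc]; omega)]
      rfl
    · refine Filter.Eventually.of_forall fun n j => ?_
      rw [norm_mul]
      refine mul_le_mul_of_nonneg_left ?_ (norm_nonneg _)
      unfold tG
      split_ifs
      · rw [div_eq_mul_inv, mul_inv, norm_mul, norm_mul]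
        exact mul_le_mul (hM _) (mul_le_mul (hM' _) (hM' _) (norm_nonneg _) hM0')
          (by positivity) hM0
      · rw [norm_zero]; positivity
  have lim2 := (tendsto_qpoch z _ hq).mul (tendsto_qpoch (s ^ 2 / z) _ hq)
  have := tendsto_nhds_unique (lim2.congr fun n => finite_triple_s12 s z hs hz hF n) lim1
  rw [tsum_mul_right] at this
  rw [jtheta, mul_assoc, this]
  field_simp

/-! ### Bilinear decomposition of `Θ(uv)Θ(u/v)` -/

/-- parity reindexing of `ℤ × ℤ` -/
def parEquiv : (ℤ × ℤ) ⊕ (ℤ × ℤ) ≃ ℤ × ℤ where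
  toFun := Sum.elim (fun p => (p.1 + p.2, p.1 - p.2)) (fun p => (p.1 + p.2 + 1, p.1 - p.2))
  invFun p := if (p.1 + p.2) % 2 = 0 then Sum.inl ((p.1 + p.2) / 2, (p.1 - p.2) / 2)
    else Sum.inr ((p.1 + p.2) / 2, (p.1 - p.2) / 2)
  left_inv := by
    rintro (⟨a, b⟩ | ⟨a, b⟩)
    · have h : (a + b + (a - b)) % 2 = 0 := by omega
      change (if (a + b + (a - b)) % 2 = 0 then
        Sum.inl ((a + b + (a - b)) / 2, (a + b - (a - b)) / 2)
        else Sum.inr ((a + b + (a - b)) / 2, (a + b - (a - b)) / 2)) = _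
      rw [if_pos h]
      simp only [Sum.inl.injEq, Prod.mk.injEq]; omega
    · have h : ¬ (a + b + 1 + (a - b)) % 2 = 0 := by omega
      simp [h]; omega
  right_inv := by
    rintro ⟨a, b⟩
    by_cases h : (a + b) % 2 = 0
    · simp [h]; omega
    · simp [h]; omega

lemma tsum_parity (f : ℤ × ℤ → ℂ) (hf : Summable f) :
    ∑' p, f p = ∑' p : ℤ × ℤ, f (p.1 + p.2, p.1 - p.2)
      + ∑' p : ℤ × ℤ, f (p.1 + p.2 + 1, p.1 - p.2) := by
  have P' : Summable (fun i => f (parEquiv i)) := parEquiv.summable_iff.2 hf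
  have hl : Summable ((fun i => f (parEquiv i)) ∘ Sum.inl) := P'.comp_injective Sum.inl_injective
  have hr : Summable ((fun i => f (parEquiv i)) ∘ Sum.inr) := P'.comp_injective Sum.inr_injective
  rw [← parEquiv.tsum_eq]
  exact (HasSum.sum (f := fun i => f (parEquiv i)) hl.hasSum hr.hasSum).tsum_eq

/-- even part series -/
def tB (s u : ℂ) (k : ℤ) : ℂ := s ^ (2 * k * k) * u ^ (2 * k)
/-- odd part series -/
def tA (s u : ℂ) (k : ℤ) : ℂ := s ^ (2 * k * k - 2 * k) * u ^ (2 * k - 1)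

lemma summable_tB (s u : ℂ) (hs : s ≠ 0) (hs1 : ‖s‖ < 1) (hu : u ≠ 0) :
    Summable (fun k => ‖tB s u k‖) := by
  have h := summable_gauss (‖s‖ ^ 2) (‖u‖ ^ 2) (by positivity)
    (pow_lt_one₀ (norm_nonneg _) hs1 (by norm_num)) (by positivity)
  refine h.congr fun k => ?_
  rw [tB, norm_mul, norm_zpow, norm_zpow, mul_assoc 2 k k, zpow_mul ‖s‖ 2 (k * k), zpow_mul ‖u‖]
  simp only [zpow_ofNat]

lemma summable_tA (s u : ℂ) (hs : s ≠ 0) (hs1 : ‖s‖ < 1) (hu : u ≠ 0) :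
    Summable (fun k => ‖tA s u k‖) := by
  have h := (summable_gauss (‖s‖ ^ 2) (‖u‖ ^ 2 / ‖s‖ ^ 2) (by positivity)
    (pow_lt_one₀ (norm_nonneg _) hs1 (by norm_num)) (by positivity)).mul_right ‖u‖⁻¹
  refine h.congr fun k => ?_
  have h1 : ‖s‖ ≠ 0 := norm_ne_zero_iff.2 hs
  have h2 : ‖u‖ ≠ 0 := norm_ne_zero_iff.2 hu
  rw [tA, norm_mul, norm_zpow, norm_zpow, zpow_sub₀ h1, zpow_sub₀ h2, zpow_one, mul_assoc 2 k k,
    zpow_mul ‖s‖ 2 (k * k), zpow_mul ‖s‖ 2 k, zpow_mul ‖u‖, div_zpow]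
  simp only [zpow_ofNat]
  ring

lemma tT_mul_even (s u v : ℂ) (hs : s ≠ 0) (hu : u ≠ 0) (hv : v ≠ 0) (k l : ℤ) :
    tT s (u * v) (k + l) * tT s (u / v) (k - l) = u * (tA s u k * tB s v l) := by
  have e1 : ((-1 : ℂ)) ^ (k + l) * (-1) ^ (k - l) = 1 := by
    rw [← zpow_add₀ (by norm_num)]
    exact Even.neg_one_zpow ⟨k, by ring⟩
  have e2 : s ^ ((k + l) * (k + l - 1)) * s ^ ((k - l) * (k - l - 1))
      = s ^ (2 * k * k - 2 * k) * s ^ (2 * l * l) := by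
    rw [← zpow_add₀ hs, ← zpow_add₀ hs]; congr 1; ring
  have e3 : u ^ (k + l) * u ^ (k - l) = u * u ^ (2 * k - 1) := by
    rw [← zpow_add₀ hu, ← zpow_one_add₀ hu]; congr 1; ring
  have e4 : v ^ (k + l) * (v ^ (k - l))⁻¹ = v ^ (2 * l) := by
    rw [← zpow_neg, ← zpow_add₀ hv]; congr 1; ring
  simp only [tT, tA, tB, mul_zpow, inv_zpow, div_eq_mul_inv]
  calc _ = ((-1 : ℂ) ^ (k + l) * (-1) ^ (k - l)) *
        (s ^ ((k + l) * (k + l - 1)) * s ^ ((k - l) * (k - l - 1))) *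
        (u ^ (k + l) * u ^ (k - l)) * (v ^ (k + l) * (v ^ (k - l))⁻¹) := by ring
    _ = _ := by rw [e1, e2, e3, e4]; ring

lemma tT_mul_odd (s u v : ℂ) (hs : s ≠ 0) (hu : u ≠ 0) (hv : v ≠ 0) (k l : ℤ) :
    tT s (u * v) (k + l + 1) * tT s (u / v) (k - l) = -u * (tB s u k * tA s v (l + 1)) := by
  have e1 : ((-1 : ℂ)) ^ (k + l + 1) * (-1) ^ (k - l) = -1 := by
    rw [← zpow_add₀ (by norm_num)]
    exact Odd.neg_one_zpow ⟨k, by ring⟩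
  have e2 : s ^ ((k + l + 1) * (k + l + 1 - 1)) * s ^ ((k - l) * (k - l - 1))
      = s ^ (2 * k * k) * s ^ (2 * (l + 1) * (l + 1) - 2 * (l + 1)) := by
    rw [← zpow_add₀ hs, ← zpow_add₀ hs]; congr 1; ring
  have e3 : u ^ (k + l + 1) * u ^ (k - l) = u * u ^ (2 * k) := by
    rw [← zpow_add₀ hu, ← zpow_one_add₀ hu]; congr 1; ring
  have e4 : v ^ (k + l + 1) * (v ^ (k - l))⁻¹ = v ^ (2 * (l + 1) - 1) := by
    rw [← zpow_neg, ← zpow_add₀ hv]; congr 1; ring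
  simp only [tT, tA, tB, mul_zpow, inv_zpow, div_eq_mul_inv]
  calc _ = ((-1 : ℂ) ^ (k + l + 1) * (-1) ^ (k - l)) *
        (s ^ ((k + l + 1) * (k + l + 1 - 1)) * s ^ ((k - l) * (k - l - 1))) *
        (u ^ (k + l + 1) * u ^ (k - l)) * (v ^ (k + l + 1) * (v ^ (k - l))⁻¹) := by ring
    _ = _ := by rw [e1, e2, e3, e4]; ring

lemma theta_bilinear (s u v : ℂ) (hs : s ≠ 0) (hs1 : ‖s‖ < 1) (hu : u ≠ 0) (hv : v ≠ 0) :
    jtheta (s ^ 2) (u * v) * jtheta (s ^ 2) (u / v)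
      = u * ((∑' k, tA s u k) * (∑' k, tB s v k) - (∑' k, tB s u k) * (∑' k, tA s v k)) := by
  have huv := mul_ne_zero hu hv
  have huv' := div_ne_zero hu hv
  have S1 := summable_tT s _ hs hs1 huv
  have S2 := summable_tT s _ hs hs1 huv'
  rw [triple_product_s12 s _ hs hs1 huv, triple_product_s12 s _ hs hs1 huv',
    tsum_mul_tsum_of_summable_norm S1 S2,
    tsum_mul_tsum_of_summable_norm (summable_tA s u hs hs1 hu) (summable_tB s v hs hs1 hv)]
  have sh : ∑' k, tA s v k = ∑' k, tA s v (k + 1) :=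
    ((Equiv.addRight (1 : ℤ)).tsum_eq (tA s v)).symm
  have sA' : Summable (fun k => ‖tA s v (k + 1)‖) :=
    (Equiv.addRight (1 : ℤ)).summable_iff.2 (summable_tA s v hs hs1 hv)
  rw [sh, tsum_mul_tsum_of_summable_norm (summable_tB s u hs hs1 hu) sA']
  have P := summable_mul_of_summable_norm S1 S2
  rw [tsum_parity _ P, mul_sub, ← tsum_mul_left, ← tsum_mul_left, sub_eq_add_neg, ← tsum_neg]
  congr 1
  · exact tsum_congr fun p => tT_mul_even s u v hs hu hv _ _
  · exact tsum_congr fun p => by rw [tT_mul_odd s u v hs hu hv]; ring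

lemma tA_inv (s u : ℂ) : ∑' k, tA s u⁻¹ k = ∑' k, tA s u k := by
  rw [← (Equiv.subLeft (1 : ℤ)).tsum_eq (tA s u)]
  refine tsum_congr fun k => ?_
  simp only [tA, Equiv.subLeft_apply, inv_zpow, ← zpow_neg]
  congr 2 <;> ring

lemma tB_inv (s u : ℂ) : ∑' k, tB s u⁻¹ k = ∑' k, tB s u k := by
  rw [← (Equiv.neg ℤ).tsum_eq (tB s u)]
  refine tsum_congr fun k => ?_
  simp only [tB, Equiv.neg_apply, inv_zpow, ← zpow_neg]
  congr 2 <;> ring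

/-- The three-term theta identity in the form needed. -/
lemma theta_key (s : ℂ) (hs : s ≠ 0) (hs1 : ‖s‖ < 1) (α β g : ℂ) (hα : α ≠ 0) (hβ : β ≠ 0)
    (hg : g ≠ 0) (w : ℂ) (hw : w ≠ 0) : ∃ C : ℂ, ∀ v : ℂ, v ≠ 0 →
    w⁻¹ * jtheta (s ^ 2) (α / β * w) * jtheta (s ^ 2) (α * β / w) *
        jtheta (s ^ 2) (β * g * w * v) * jtheta (s ^ 2) (β / g * w / v)
      - w * jtheta (s ^ 2) (α / β / w) * jtheta (s ^ 2) (α * β * w) *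
        jtheta (s ^ 2) (β * g * v / w) * jtheta (s ^ 2) (β / g / (w * v))
      = C * (jtheta (s ^ 2) (α * g * v) * jtheta (s ^ 2) (α / g / v)) := by
  let P := fun u => ∑' k, tA s u k
  let Q := fun u => ∑' k, tB s u k
  have hS : ∀ u v, u ≠ 0 → v ≠ 0 → jtheta (s ^ 2) (u * v) * jtheta (s ^ 2) (u / v)
      = u * (P u * Q v - Q u * P v) := fun u v hu hv => theta_bilinear s u v hs hs1 hu hv
  have hP : ∀ u, P u⁻¹ = P u := tA_inv s
  have hQ : ∀ u, Q u⁻¹ = Q u := tB_inv s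
  refine ⟨β * (Q (w / β) * P (w * β) - Q (w * β) * P (w / β)), fun v hv => ?_⟩
  have h1 := hS α (w / β) hα (div_ne_zero hw hβ)
  have h2 := hS (w * β) (g * v) (mul_ne_zero hw hβ) (mul_ne_zero hg hv)
  have h3 := hS α (w * β) hα (mul_ne_zero hw hβ)
  have h4 := hS (β / w) (g * v) (div_ne_zero hβ hw) (mul_ne_zero hg hv)
  have h5 := hS α (g * v) hα (mul_ne_zero hg hv)
  have i1 : P (β / w) = P (w / β) := by rw [← hP, inv_div]
  have i2 : Q (β / w) = Q (w / β) := by rw [← hQ, inv_div]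
  rw [i1, i2] at h4
  rw [show α * (w / β) = α / β * w by ring, show α / (w / β) = α * β / w by field_simp] at h1
  rw [show w * β * (g * v) = β * g * w * v by ring,
    show w * β / (g * v) = β / g * w / v by field_simp] at h2
  rw [show α * (w * β) = α * β * w by ring, show α / (w * β) = α / β / w by field_simp] at h3
  rw [show β / w * (g * v) = β * g * v / w by ring,
    show β / w / (g * v) = β / g / (w * v) by field_simp] at h4
  rw [show α * (g * v) = α * g * v by ring, show α / (g * v) = α / g / v by field_simp] at h5
  rw [h5]
  calc _ = w⁻¹ * (jtheta (s ^ 2) (α / β * w) * jtheta (s ^ 2) (α * β / w)) *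
        (jtheta (s ^ 2) (β * g * w * v) * jtheta (s ^ 2) (β / g * w / v))
      - w * (jtheta (s ^ 2) (α * β * w) * jtheta (s ^ 2) (α / β / w)) *
        (jtheta (s ^ 2) (β * g * v / w) * jtheta (s ^ 2) (β / g / (w * v))) := by ring
    _ = _ := by
      rw [h1, h2, h3, h4]
      field_simp
      ring

/-! ### The chain of sign sums -/

lemma chain_sum (g : ℕ → ℂ → ℂ) (T : ℕ → ℂ → ℂ → ℂ) (R : ℕ → ℂ → ℂ) (w : ℕ → ℂ) (n : ℕ)
    (hend : g n (w n) * w n * R n (w n) + g n (w n)⁻¹ * (w n)⁻¹ * R n (w n)⁻¹ = 0)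
    (hstep : ∀ k, 1 ≤ k → k < n → ∃ C : ℂ, ∀ v, (v = w (k + 1) ∨ v = (w (k + 1))⁻¹) →
      g k (w k) * R k (w k) * T (k + 1) (w k) v
        + g k (w k)⁻¹ * R k (w k)⁻¹ * T (k + 1) (w k)⁻¹ v = C * R (k + 1) v)
    (m : ℕ) : ∀ k, 1 ≤ k → k + m = n →
    ∑ S ∈ (Finset.Icc k n).powerset,
      ((∏ j ∈ Finset.Icc k n, g j (if j ∈ S then w j else (w j)⁻¹)) *
        (if n ∈ S then w n else (w n)⁻¹) *
        (∏ j ∈ Finset.Icc (k + 1) n, T j (if j - 1 ∈ S then w (j - 1) else (w (j - 1))⁻¹)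
          (if j ∈ S then w j else (w j)⁻¹)) *
        R k (if k ∈ S then w k else (w k)⁻¹)) = 0 := by
  induction m with
  | zero =>
    intro k _ hk
    obtain rfl : k = n := by omega
    have : (Finset.Icc k k).powerset = {∅, {k}} := by
      rw [Finset.Icc_self]; ext S; simp [Finset.subset_singleton_iff]
    rw [this, Finset.sum_pair (by simp)]
    simp
    linear_combination hend
  | succ m ih =>
    intro k hk1 hk
    have ih := ih (k + 1) (by omega) (by omega)
    have hI : Finset.Icc k n = insert k (Finset.Icc (k + 1) n) := by
      ext j; simp only [Finset.mem_Icc, Finset.mem_insert]; omega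
    have hI2 : Finset.Icc (k + 1) n = insert (k + 1) (Finset.Icc (k + 2) n) := by
      ext j; simp only [Finset.mem_Icc, Finset.mem_insert]; omega
    have hk' : k ∉ Finset.Icc (k + 1) n := by simp
    have hk2 : k + 1 ∉ Finset.Icc (k + 2) n := by simp
    obtain ⟨C, hC⟩ := hstep k hk1 (by omega)
    rw [hI, Finset.sum_powerset_insert hk', ← Finset.sum_add_distrib]
    rw [← mul_zero C, ← ih, Finset.mul_sum]
    refine Finset.sum_congr rfl fun S hS => ?_
    have hkS : k ∉ S := fun h => hk' (Finset.mem_powerset.1 hS h)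
    rw [Finset.prod_insert hk', Finset.prod_insert hk']
    have p1 : ∏ j ∈ Finset.Icc (k + 1) n, g j (if j ∈ insert k S then w j else (w j)⁻¹)
        = ∏ j ∈ Finset.Icc (k + 1) n, g j (if j ∈ S then w j else (w j)⁻¹) := by
      refine Finset.prod_congr rfl fun j hj => ?_
      have : j ≠ k := by rintro rfl; exact hk' hj
      simp [this]
    rw [p1]
    have q1 : ∀ S : Finset ℕ, ∏ j ∈ Finset.Icc (k + 1) n,
        T j (if j - 1 ∈ S then w (j - 1) else (w (j - 1))⁻¹) (if j ∈ S then w j else (w j)⁻¹)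
        = T (k + 1) (if k ∈ S then w k else (w k)⁻¹)
            (if k + 1 ∈ S then w (k + 1) else (w (k + 1))⁻¹) *
          ∏ j ∈ Finset.Icc (k + 2) n,
        T j (if j - 1 ∈ S then w (j - 1) else (w (j - 1))⁻¹)
          (if j ∈ S then w j else (w j)⁻¹) := by
      intro S
      rw [hI2, Finset.prod_insert hk2]; rfl
    rw [q1, q1]
    have p2 : ∏ j ∈ Finset.Icc (k + 2) n,
        T j (if j - 1 ∈ insert k S then w (j - 1) else (w (j - 1))⁻¹)
          (if j ∈ insert k S then w j else (w j)⁻¹)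
        = ∏ j ∈ Finset.Icc (k + 2) n,
        T j (if j - 1 ∈ S then w (j - 1) else (w (j - 1))⁻¹)
          (if j ∈ S then w j else (w j)⁻¹) := by
      refine Finset.prod_congr rfl fun j hj => ?_
      have hj := (Finset.mem_Icc.1 hj).1
      have a1 : j ≠ k := by omega
      have a2 : j - 1 ≠ k := by omega
      simp [a1, a2]
    rw [p2]
    have b1 : n ≠ k := by omega
    have e1 : (if n ∈ insert k S then w n else (w n)⁻¹) = if n ∈ S then w n else (w n)⁻¹ := by
      simp [b1]
    have e2 : (if k + 1 ∈ insert k S then w (k + 1) else (w (k + 1))⁻¹)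
        = if k + 1 ∈ S then w (k + 1) else (w (k + 1))⁻¹ := by
      simp
    have e3 : (if k ∈ insert k S then w k else (w k)⁻¹) = w k := by simp
    rw [e1, e2, e3, if_neg hkS]
    have hv := hC (if k + 1 ∈ S then w (k + 1) else (w (k + 1))⁻¹) (by split_ifs <;> simp)
    generalize (if k + 1 ∈ S then w (k + 1) else (w (k + 1))⁻¹) = v at hv ⊢
    generalize (∏ j ∈ Finset.Icc (k + 1) n, g j (if j ∈ S then w j else (w j)⁻¹)) = X
    generalize (∏ j ∈ Finset.Icc (k + 2) n,
        T j (if j - 1 ∈ S then w (j - 1) else (w (j - 1))⁻¹)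
          (if j ∈ S then w j else (w j)⁻¹)) = Y
    generalize (if n ∈ S then w n else (w n)⁻¹) = Z
    linear_combination (X * Y * Z) * hv

/-! ### Powers of `x` -/

lemma cxp_add (x : ℝ) (a b : ℂ) : cxp x (a + b) = cxp x a * cxp x b := by
  rw [cxp, cxp, cxp, ← Complex.exp_add, add_mul]

lemma cxp_sub (x : ℝ) (a b : ℂ) : cxp x (a - b) = cxp x a / cxp x b := by
  rw [cxp, cxp, cxp, ← Complex.exp_sub, sub_mul]

lemma cxp_ne (x : ℝ) (a : ℂ) : cxp x a ≠ 0 := Complex.exp_ne_zero _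

lemma cxp_one (x : ℝ) (hx : 0 < x) : cxp x 1 = x := by
  rw [cxp, one_mul, ← Complex.ofReal_exp, Real.exp_log hx]

lemma cxp_two (x : ℝ) (r : ℝ) : cxp x (2 * r) = cxp x r ^ 2 := by
  rw [two_mul, cxp_add, sq]

lemma cxp_norm_lt (x : ℝ) (hx : 0 < x) (hx1 : x < 1) (r : ℝ) (hr : 0 < r) : ‖cxp x r‖ < 1 := by
  rw [cxp, ← Complex.ofReal_mul, Complex.norm_exp, Complex.ofReal_re, Real.exp_lt_one_iff]
  exact mul_neg_of_pos_of_neg hr (Real.log_neg hx hx1)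

/-- the moving right factor -/
def RB (x r c : ℝ) (π : ℕ → ℝ) (μ : ℕ) (j : ℕ) (v : ℂ) : ℂ :=
  jtheta (cxp x (2 * r)) (cxp x (2 * (π 1 - π j) + 2 * c + 2 - j) * v) *
    jtheta (cxp x (2 * r)) (cxp x (2 * (π 1 - π μ) + 2 * c - j) / v)

lemma key_level (x : ℝ) (hx0 : 0 < x) (hx1 : x < 1) (r : ℝ) (hr : 0 < r) (c : ℝ) (π : ℕ → ℝ)
    (μ k : ℕ) (w : ℂ) (hw : w ≠ 0) : ∃ C : ℂ, ∀ v : ℂ, v ≠ 0 →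
    w⁻¹ * jtheta (cxp x (2 * r)) (cxp x (2 * c + 2 * (π 1 - π (k + 1)) - k) * w) *
        jtheta (cxp x (2 * r)) (cxp x (2 * (π 1 - π μ) + 2 * c - k) / w) *
        jtheta (cxp x (2 * r)) (x * w * v) *
        jtheta (cxp x (2 * r)) (cxp x (2 * (π (k + 1) - π μ) - 1) * w / v)
      - w * jtheta (cxp x (2 * r)) (cxp x (2 * c + 2 * (π 1 - π (k + 1)) - k) / w) *
        jtheta (cxp x (2 * r)) (cxp x (2 * (π 1 - π μ) + 2 * c - k) * w) *
        jtheta (cxp x (2 * r)) (x * v / w) *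
        jtheta (cxp x (2 * r)) (cxp x (2 * (π (k + 1) - π μ) - 1) / (w * v))
      = C * RB x r c π μ (k + 1) v := by
  have key := theta_key (cxp x r) (cxp_ne _ _) (cxp_norm_lt x hx0 hx1 r hr)
    (cxp x (2 * π 1 - π (k + 1) - π μ + 2 * c - k)) (cxp x (π (k + 1) - π μ))
    (cxp x (1 - (π (k + 1) - π μ))) (cxp_ne _ _) (cxp_ne _ _) (cxp_ne _ _) w hw
  simp only [← cxp_add, ← cxp_sub, ← cxp_two] at key
  have e1 : (2 * (π 1 : ℂ) - π (k + 1) - π μ + 2 * c - k - (π (k + 1) - π μ))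
    = 2 * c + 2 * (π 1 - π (k + 1)) - k := by ring
  have e2 : (2 * (π 1 : ℂ) - π (k + 1) - π μ + 2 * c - k + (π (k + 1) - π μ))
    = 2 * (π 1 - π μ) + 2 * c - k := by ring
  have e3 : ((π (k + 1) : ℂ) - π μ + (1 - (π (k + 1) - π μ))) = 1 := by ring
  have e4 : ((π (k + 1) : ℂ) - π μ - (1 - (π (k + 1) - π μ)))
    = 2 * (π (k + 1) - π μ) - 1 := by ring
  have e5 : (2 * (π 1 : ℂ) - π (k + 1) - π μ + 2 * c - k + (1 - (π (k + 1) - π μ)))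
    = 2 * (π 1 - π (k + 1)) + 2 * c + 2 - ((k + 1 : ℕ) : ℂ) := by push_cast; ring
  have e6 : (2 * (π 1 : ℂ) - π (k + 1) - π μ + 2 * c - k - (1 - (π (k + 1) - π μ)))
    = 2 * (π 1 - π μ) + 2 * c - ((k + 1 : ℕ) : ℂ) := by push_cast; ring
  rw [e1, e2, e3, e4, e5, e6, cxp_one x hx0] at key
  exact key

lemma gB_form (x r c : ℝ) (hx0 : 0 < x) (hx1 : x < 1) (hr : 0 < r) (π : ℕ → ℝ) (j : ℕ) (w : ℂ)
    (hw : w ≠ 0)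
    (hden : ∀ v : ℂ, (v = w ∨ v = w⁻¹) →
      qpoch (cxp x (2 * r - 2 * (π 1 - π j) - 2 * c - 2 + j) / v) (cxp x (2 * r)) ≠ 0 ∧
      qpoch (cxp x (2 * c + 2 * (π 1 - π (j + 1)) - j) / v) (cxp x (2 * r)) ≠ 0) :
    ∃ K : ℂ, ∀ v : ℂ, (v = w ∨ v = w⁻¹) → gB x r c π j v = K * ((1 - (v⁻¹) ^ 2) *
      jtheta (cxp x (2 * r)) (cxp x (2 * (π 1 - π j) + 2 * c + 2 - j) / v) *
      jtheta (cxp x (2 * r)) (cxp x (2 * c + 2 * (π 1 - π (j + 1)) - j) * v)) := by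
  have hq : ‖cxp x (2 * r)‖ < 1 := by
    rw [cxp_two, norm_pow]
    exact pow_lt_one₀ (norm_nonneg _) (cxp_norm_lt x hx0 hx1 r hr) (by norm_num)
  have hQ := qpoch_self_ne _ hq
  have E1 : cxp x (2 * r - 2 * (π 1 - π j) - 2 * c - 2 + j)
      = cxp x (2 * r) / cxp x (2 * (π 1 - π j) + 2 * c + 2 - j) := by
    rw [← cxp_sub]; congr 1; ring
  have E2 : cxp x (-2 * (π 1 - π (j + 1)) + 2 * r - 2 * c + j)
      = cxp x (2 * r) / cxp x (2 * c + 2 * (π 1 - π (j + 1)) - j) := by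
    rw [← cxp_sub]; congr 1; ring
  simp only [gB, jtheta]
  simp only [E1] at hden
  simp only [E1, E2]
  clear E1 E2
  have hA := cxp_ne x (2 * (π 1 - π j) + 2 * c + 2 - j)
  have hD := cxp_ne x (2 * c + 2 * (π 1 - π (j + 1)) - j)
  generalize cxp x (2 * (π 1 - π j) + 2 * c + 2 - j) = A at *
  generalize cxp x (2 * c + 2 * (π 1 - π (j + 1)) - j) = D at *
  generalize cxp x (2 * r) = q at *
  obtain ⟨d1, d2⟩ := hden w (Or.inl rfl)
  obtain ⟨d3, d4⟩ := hden w⁻¹ (Or.inr rfl)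
  refine ⟨1 / (qpoch q q ^ 2 * (qpoch (q / A / w) q * qpoch (D / w) q *
    (qpoch (q / A / w⁻¹) q * qpoch (D / w⁻¹) q))), ?_⟩
  rintro v (rfl | rfl)
  · rw [show q / (A / v) = q / A / v⁻¹ by field_simp, show q / (D * v) = q / D / v by field_simp,
      show D * v = D / v⁻¹ by field_simp]
    generalize qpoch (q / A / v) q = a1 at *
    generalize qpoch (D / v) q = a2 at *
    generalize qpoch (q / A / v⁻¹) q = a3 at *
    generalize qpoch (D / v⁻¹) q = a4 at *
    field_simp
  · rw [show q / (A / w⁻¹) = q / A / w by field_simp,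
      show q / (D * w⁻¹) = q / D / w⁻¹ by field_simp,
      show D * w⁻¹ = D / w by field_simp]
    generalize qpoch (q / A / w) q = a1 at *
    generalize qpoch (D / w) q = a2 at *
    generalize qpoch (q / A / w⁻¹) q = a3 at *
    generalize qpoch (D / w⁻¹) q = a4 at *
    field_simp

/-- The weak equality `E ∼_{(w_1,…,w_{μ-1})} 0`: summing `E` over all `2^{μ-1}`
sign choices `w_i ↦ w_i^{±1}` (encoded by the subset `S` of indices kept unflipped)
gives zero. -/
theorem weak_equality_E (x : ℝ) (hx0 : 0 < x) (hx1 : x < 1)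
    (r : ℝ) (hr : 0 < r) (μ : ℕ) (hμ : 2 ≤ μ) (c : ℝ) (π : ℕ → ℝ)
    (z : ℂ) (hz : z ≠ 0) (w : ℕ → ℂ)
    (hw : ∀ k ∈ Finset.Icc 1 (μ - 1), w k ≠ 0)
    (hden : ∀ j ∈ Finset.Icc 1 (μ - 1), ∀ v : ℂ, (v = w j ∨ v = (w j)⁻¹) →
      qpoch (cxp x (2 * r - 2 * (π 1 - π j) - 2 * c - 2 + j) / v) (cxp x (2 * r)) ≠ 0 ∧
      qpoch (cxp x (2 * c + 2 * (π 1 - π (j + 1)) - j) / v) (cxp x (2 * r)) ≠ 0) :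
    ∑ S ∈ (Finset.Icc 1 (μ - 1)).powerset,
      Ebig x r c π μ z (fun k => if k ∈ S then w k else (w k)⁻¹) = 0 := by
  obtain ⟨n, rfl⟩ : ∃ n, μ = n + 1 := ⟨μ - 1, by omega⟩
  simp only [Nat.add_sub_cancel] at *
  obtain ⟨C0, hC0⟩ := key_level x hx0 hx1 r hr c π (n + 1) 0 z hz
  have hchain := chain_sum (gB x r c π)
    (fun j u v => jtheta (cxp x (2 * r)) ((x : ℂ) * u * v) *
      jtheta (cxp x (2 * r)) (cxp x (2 * (π j - π (n + 1)) - 1) * u / v))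
    (RB x r c π (n + 1)) w n ?_ ?_ (n - 1) 1 le_rfl (by omega)
  · rw [← mul_zero (-C0), ← hchain, Finset.mul_sum]
    refine Finset.sum_congr rfl fun S _ => ?_
    have hw1 : (if 1 ∈ S then w 1 else (w 1)⁻¹) ≠ 0 := by
      have := hw 1 (Finset.mem_Icc.2 ⟨le_rfl, by omega⟩)
      split_ifs
      · exact this
      · exact inv_ne_zero this
    have h := hC0 _ hw1
    simp only [zero_add, sub_self, mul_zero, add_zero, Nat.cast_zero, sub_zero] at h
    simp only [Ebig, Nat.add_sub_cancel]
    generalize (if 1 ∈ S then w 1 else (w 1)⁻¹) = v at h ⊢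
    rw [show (1 + 1 : ℕ) = 2 from rfl]
    linear_combination (-((∏ j ∈ Finset.Icc 1 n, gB x r c π j (if j ∈ S then w j else (w j)⁻¹)) *
      (if n ∈ S then w n else (w n)⁻¹) *
      ∏ j ∈ Finset.Icc 2 n, (jtheta (cxp x (2 * r)) ((x : ℂ) *
        (if j - 1 ∈ S then w (j - 1) else (w (j - 1))⁻¹) * (if j ∈ S then w j else (w j)⁻¹)) *
      jtheta (cxp x (2 * r)) (cxp x (2 * (π j - π (n + 1)) - 1) *
        (if j - 1 ∈ S then w (j - 1) else (w (j - 1))⁻¹) /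
          (if j ∈ S then w j else (w j)⁻¹))))) * h
  · have hn : n ∈ Finset.Icc 1 n := Finset.mem_Icc.2 ⟨by omega, le_rfl⟩
    have hwn := hw n hn
    obtain ⟨K, hK⟩ := gB_form x r c hx0 hx1 hr π n (w n) hwn (hden n hn)
    rw [hK _ (Or.inl rfl), hK _ (Or.inr rfl)]
    have e : (2 * (c : ℂ) + 2 * (π 1 - π (n + 1)) - n) = 2 * (π 1 - π (n + 1)) + 2 * c - n := by
      ring
    simp only [RB, e, inv_inv, div_inv_eq_mul, ← div_eq_mul_inv]
    field_simp
    ring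
  · intro k hk1 hkn
    have hk : k ∈ Finset.Icc 1 n := Finset.mem_Icc.2 ⟨hk1, by omega⟩
    have hwk := hw k hk
    have hwk1 := hw (k + 1) (Finset.mem_Icc.2 ⟨by omega, by omega⟩)
    obtain ⟨K, hK⟩ := gB_form x r c hx0 hx1 hr π k (w k) hwk (hden k hk)
    obtain ⟨C, hC⟩ := key_level x hx0 hx1 r hr c π (n + 1) k (w k) hwk
    rw [hK _ (Or.inl rfl), hK _ (Or.inr rfl)]
    refine ⟨K * (w k - (w k)⁻¹) *
      jtheta (cxp x (2 * r)) (cxp x (2 * (π 1 - π k) + 2 * c + 2 - k) / w k) *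
      jtheta (cxp x (2 * r)) (cxp x (2 * (π 1 - π k) + 2 * c + 2 - k) * w k) * C, fun v hv => ?_⟩
    have hv0 : v ≠ 0 := by
      rcases hv with rfl | rfl
      · exact hwk1
      · exact inv_ne_zero hwk1
    rw [mul_assoc _ C, ← hC v hv0]
    simp only [RB, inv_inv, div_inv_eq_mul, ← div_eq_mul_inv]
    rw [show (x : ℂ) / w k * v = x * v / w k by ring,
      show cxp x (2 * (π (k + 1) - π (n + 1)) - 1) / w k / v
        = cxp x (2 * (π (k + 1) - π (n + 1)) - 1) / (w k * v) by rw [div_div]]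
    field_simp
    ring
end
end
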